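/- arXiv:2303.02055 — 2 statements merged into one kernel-verified Lean document; each statement's English description precedes it below -/
import Mathlib

section
/- There exists δ₁ ∈ (0, 1/2) such that for every δ ∈ (0, δ₁) there exist a compact set K ⊂ ℝ×{0} ⊂ ℝ², a Borel probability measure μ with support equal to K, a constant C₀ ≥ 1 with C₀^{−1} ρ^δ ≤ μ(B(x,ρ)) ≤ C₀ ρ^δ for all x ∈ K and 0 < ρ ≤ diam K (so K is Ahlfors regular of dimension δ), and a real constant c such that ∫_K ln|y−x| dμ(x) = c for every y ∈ K. In other words, the logarithmic potential of μ is constant on K, so μ is the equilibrium measure of K and is boundedly equivalent to 𝓗^δ restricted to K. -/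
open MeasureTheory

namespace LogPot

abbrev Om := ℕ → Bool

def tr (n : ℕ) (w : Om) : Om := fun i => if i < n then w i else false

def S (n : ℕ) (w : Om) : Set Om := {x | (∀ i < n, x i = w i) ∧ x n ≠ w n}

def Cyl (n : ℕ) (w : Om) : Set Om := {x | ∀ i < n, x i = w i}

def sg (b : Bool) : ℝ := if b then 1 else -1

lemma abs_sg (b : Bool) : |sg b| = 1 := by cases b <;> simp [sg]

lemma exists_coin : ∃ ν : Measure Om, IsProbabilityMeasure ν ∧
    ∀ n w, ν.real (Cyl n w) = (1/2 : ℝ) ^ n := by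
  let c : Measure Bool := (PMF.uniformOfFintype Bool).toMeasure
  have hc : ∀ b, c {b} = 2⁻¹ := by
    intro b
    simp [c]
  refine ⟨Measure.infinitePi (fun _ : ℕ => c), inferInstance, ?_⟩
  intro n w
  have h : Cyl n w = Set.pi (Finset.range n) (fun i => {w i}) := by
    ext x; simp [Cyl]
  rw [h, Measure.real, Measure.infinitePi_pi]
  · simp [hc]
  · intro i _; exact MeasurableSet.singleton _

lemma measurableSet_cyl (n : ℕ) (w : Om) : MeasurableSet (Cyl n w) := by
  have h : Cyl n w = Set.pi (Finset.range n) (fun i => {w i}) := by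
    ext x; simp [Cyl]
  rw [h]
  exact MeasurableSet.pi (Finset.countable_toSet _) (fun i _ => MeasurableSet.singleton _)

lemma S_eq (n : ℕ) (w : Om) : S n w = Cyl n w \ Cyl (n+1) w := by
  ext x
  simp only [S, Cyl, Set.mem_ofPred_eq, Set.mem_sdiff]
  constructor
  · rintro ⟨h1, h2⟩
    exact ⟨h1, fun h => h2 (h n (by omega))⟩
  · rintro ⟨h1, h2⟩
    refine ⟨h1, fun h => h2 fun i hi => ?_⟩
    rcases Nat.lt_succ_iff_lt_or_eq.mp hi with h3 | h3
    · exact h1 i h3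
    · rw [h3, h]

lemma measurableSet_S (n : ℕ) (w : Om) : MeasurableSet (S n w) := by
  rw [S_eq]; exact (measurableSet_cyl _ _).diff (measurableSet_cyl _ _)

lemma S_congr {n p : ℕ} (h : n < p) {w w' : Om} (hw : ∀ i < p, w i = w' i) : S n w = S n w' := by
  ext x
  simp only [S, Set.mem_ofPred_eq]
  rw [hw n h]
  constructor
  · rintro ⟨h1, h2⟩; exact ⟨fun i hi => (h1 i hi).trans (hw i (by omega)), h2⟩
  · rintro ⟨h1, h2⟩; exact ⟨fun i hi => (h1 i hi).trans (hw i (by omega)).symm, h2⟩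


lemma real_S {ν : Measure Om} [IsProbabilityMeasure ν]
    (hν : ∀ n w, ν.real (Cyl n w) = (1/2 : ℝ) ^ n)
    (n : ℕ) (w : Om) : ν.real (S n w) = (1/2 : ℝ) ^ (n+1) := by
  rw [S_eq, measureReal_sdiff _ (measurableSet_cyl _ _), hν, hν, pow_succ]
  · ring
  · intro x hx i hi; exact hx i (by omega)

lemma null_singleton {ν : Measure Om} [IsProbabilityMeasure ν]
    (hν : ∀ n w, ν.real (Cyl n w) = (1/2 : ℝ) ^ n)
    (w : Om) : ν {w} = 0 := by
  have h : ν.real {w} ≤ 0 := by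
    refine ge_of_tendsto' (tendsto_pow_atTop_nhds_zero_of_lt_one
      (by norm_num : (0:ℝ) ≤ 1/2) (by norm_num)) (fun n => ?_)
    rw [← hν n w]
    refine measureReal_mono ?_
    rintro x rfl i _
    rfl
  have h2 := le_antisymm h measureReal_nonneg
  exact (measureReal_eq_zero_iff).mp h2

lemma iUnion_S (w : Om) : ⋃ n, S n w = {w}ᶜ := by
  ext x
  simp only [Set.mem_iUnion, Set.mem_compl_iff, Set.mem_singleton_iff]
  constructor
  · rintro ⟨n, _, h2⟩ rfl; exact h2 rfl
  · intro h
    have h' : ∃ n, x n ≠ w n := by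
      by_contra hh; push Not at hh; exact h (funext hh)
    classical
    refine ⟨Nat.find h', fun i hi => ?_, Nat.find_spec h'⟩
    by_contra hc
    exact Nat.find_min h' hi hc

lemma disj_S (w : Om) : Pairwise (Function.onFun Disjoint (fun n => S n w)) := by
  intro m n hmn
  refine Set.disjoint_left.mpr ?_
  rintro x ⟨h1, h2⟩ ⟨h3, h4⟩
  rcases lt_or_gt_of_ne hmn with h | h
  · exact h2 (h3 _ h)
  · exact h4 (h1 _ h)

/-- Manual Banach fixed point. -/
lemma fixed {ι : Type*} (F : (ι → ℝ) → (ι → ℝ))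
    (h1 : ∀ a, (∀ i, |a i| ≤ 1) → ∀ i, |F a i| ≤ 1)
    (h2 : ∀ a b, (∀ i, |a i| ≤ 1) → (∀ i, |b i| ≤ 1) → ∀ D, (∀ i, |a i - b i| ≤ D) →
      ∀ i, |F a i - F b i| ≤ D / 2) :
    ∃ a, (∀ i, |a i| ≤ 1) ∧ F a = a := by
  let s : ℕ → ι → ℝ := fun n => F^[n] 0
  have s_succ : ∀ n, s (n+1) = F (s n) := fun n => Function.iterate_succ_apply' F n 0
  have hs : ∀ n i, |s n i| ≤ 1 := by
    intro n
    induction n with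
    | zero => intro i; simp [s]
    | succ n ih => rw [s_succ]; exact h1 _ ih
  have hd : ∀ n i, |s n i - s (n+1) i| ≤ 2 / 2 / 2 ^ n := by
    intro n
    induction n with
    | zero =>
      intro i
      have := hs 1 i
      simpa [s] using this
    | succ n ih =>
      intro i
      have := h2 _ _ (hs n) (hs (n+1)) _ ih i
      rw [← s_succ, ← s_succ] at this
      refine this.trans (le_of_eq ?_)
      rw [pow_succ]; field_simp
  have hc : ∀ i, CauchySeq (fun n => s n i) := fun i =>
    cauchySeq_of_le_geometric_two (C := 2) (fun n => by rw [Real.dist_eq]; exact hd n i)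
  choose a ha using fun i => cauchySeq_tendsto_of_complete (hc i)
  have ha1 : ∀ i, |a i| ≤ 1 := fun i => le_of_tendsto' (ha i).abs (fun n => hs n i)
  have had : ∀ n i, |s n i - a i| ≤ 2 / 2 ^ n := fun n i => by
    have := dist_le_of_le_geometric_two_of_tendsto (C := 2)
      (fun n => by rw [Real.dist_eq]; exact hd n i) (ha i) n
    rwa [Real.dist_eq] at this
  refine ⟨a, ha1, funext fun i => ?_⟩
  have hz : Filter.Tendsto (fun n : ℕ => (2:ℝ) / 2 ^ n / 2) Filter.atTop (nhds 0) := by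
    have := tendsto_pow_atTop_nhds_zero_of_lt_one
      (by norm_num : (0:ℝ) ≤ 1/2) (by norm_num)
    refine this.congr (fun n => ?_)
    rw [div_pow, one_pow]; field_simp
  have h3 : Filter.Tendsto (fun n => s (n+1) i) Filter.atTop (nhds (F a i)) := by
    rw [tendsto_iff_dist_tendsto_zero]
    refine squeeze_zero (fun _ => dist_nonneg) (fun n => ?_) hz
    rw [s_succ, Real.dist_eq]
    exact h2 _ _ (hs n) ha1 _ (had n) i
  exact tendsto_nhds_unique h3 ((ha i).comp (Filter.tendsto_add_atTop_nat 1))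

/-- Summation lemma. -/
lemma sum_bound (f : ℕ → ℝ) (p : ℕ) (M : ℝ)
    (h1 : ∀ k, k < p → |f k| ≤ M * (1/2) ^ p * (1/2) ^ (p - 1 - k))
    (h2 : ∀ k, |f (k + p)| ≤ M * (1/2) ^ p * (1/2) ^ (k+1)) :
    |∑' n, f n| ≤ 3 * M * (1/2) ^ p := by
  have hM : 0 ≤ M * (1/2) ^ p := by
    have := (abs_nonneg _).trans (h2 0)
    by_contra hh
    push Not at hh
    linarith [mul_neg_of_neg_of_pos hh (by norm_num : (0:ℝ) < (1/2)^(0+1))]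
  have hg : HasSum (fun k : ℕ => M * (1/2) ^ p * (1/2 : ℝ) ^ (k+1)) (M * (1/2) ^ p) := by
    have := (hasSum_geometric_two).mul_left (M * (1/2) ^ p * (1/2))
    have e : M * (1/2) ^ p * (1/2) * 2 = M * (1/2) ^ p := by ring
    have e2 : (fun k : ℕ => M * (1/2) ^ p * (1/2) * (1/2 : ℝ) ^ k) =
        (fun k : ℕ => M * (1/2) ^ p * (1/2 : ℝ) ^ (k+1)) := by
      funext k; rw [pow_succ]; ring
    rwa [e, e2] at this
  have hsm : Summable (fun k => f (k + p)) :=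
    Summable.of_norm_bounded hg.summable (fun k => by simpa using h2 k)
  have hs : Summable f := (summable_nat_add_iff p).mp hsm
  rw [← hs.sum_add_tsum_nat_add p]
  have e1 : |∑' k, f (k + p)| ≤ M * (1/2) ^ p := by
    have := tsum_of_norm_bounded (f := fun k => f (k + p)) hg (fun k => h2 k)
    exact this
  have e2 : |∑ i ∈ Finset.range p, f i| ≤ 2 * (M * (1/2) ^ p) := by
    calc |∑ i ∈ Finset.range p, f i| ≤ ∑ i ∈ Finset.range p, |f i| := Finset.abs_sum_le_sum_abs _ _
      _ ≤ ∑ i ∈ Finset.range p, M * (1/2) ^ p * (1/2) ^ (p - 1 - i) :=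
        Finset.sum_le_sum (fun i hi => h1 i (Finset.mem_range.mp hi))
      _ = M * (1/2) ^ p * ∑ i ∈ Finset.range p, (1/2 : ℝ) ^ (p - 1 - i) := by rw [Finset.mul_sum]
      _ = M * (1/2) ^ p * ∑ i ∈ Finset.range p, (1/2 : ℝ) ^ i := by
        rw [Finset.sum_range_reflect (fun i => (1/2 : ℝ) ^ i)]
      _ ≤ M * (1/2) ^ p * 2 := by
        gcongr
        have := summable_geometric_two.sum_le_tsum (Finset.range p) (fun i _ => by positivity)
        rwa [tsum_geometric_two] at this
      _ = _ := by ring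
  calc _ ≤ _ := abs_add_le _ _
    _ ≤ _ := add_le_add e2 e1
    _ = _ := by ring

lemma log_diff {A B : ℝ} (hA : 1/2 ≤ A) (hB : 1/2 ≤ B) :
    |Real.log A - Real.log B| ≤ 2 * |A - B| := by
  have key : ∀ A B : ℝ, 1/2 ≤ A → 1/2 ≤ B → Real.log A - Real.log B ≤ 2 * |A - B| := by
    intro A B hA hB
    rw [← Real.log_div (by linarith) (by linarith)]
    have h := Real.log_le_sub_one_of_pos (show 0 < A / B by apply div_pos <;> linarith)
    have e : A / B - 1 = (A - B) / B := by field_simp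
    rw [e] at h
    refine h.trans ?_
    rw [div_le_iff₀ (by linarith)]
    have := le_abs_self (A - B)
    have := abs_nonneg (A - B)
    nlinarith
  rw [abs_le]
  have h1 := key A B hA hB
  have h2 := key B A hB hA
  rw [abs_sub_comm B A] at h2
  constructor <;> linarith

lemma log_four {A B A' B' : ℝ} (hA : 1/2 ≤ A) (hB : 1/2 ≤ B) (hA' : 1/2 ≤ A') (hB' : 1/2 ≤ B')
    (hB2 : B' ≤ 2) :
    |(Real.log A - Real.log B) - (Real.log A' - Real.log B')| ≤
      4 * (2 * |(A - B) - (A' - B')| + |A' - B'| * |B' - B|) := by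
  have key : ∀ x y : ℝ, 1/4 ≤ x → 1/4 ≤ y → Real.log x - Real.log y ≤ 4 * |x - y| := by
    intro A B hA hB
    rw [← Real.log_div (by linarith) (by linarith)]
    have h := Real.log_le_sub_one_of_pos (show 0 < A / B by apply div_pos <;> linarith)
    have e : A / B - 1 = (A - B) / B := by field_simp
    rw [e] at h
    refine h.trans ?_
    rw [div_le_iff₀ (by linarith)]
    have := le_abs_self (A - B)
    have := abs_nonneg (A - B)
    nlinarith
  have e : (Real.log A - Real.log B) - (Real.log A' - Real.log B') =
      Real.log (A * B') - Real.log (B * A') := by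
    rw [Real.log_mul (by linarith) (by linarith), Real.log_mul (by linarith) (by linarith)]
    ring
  have hx : 1/4 ≤ A * B' := by nlinarith
  have hy : 1/4 ≤ B * A' := by nlinarith
  have h1 : |Real.log (A * B') - Real.log (B * A')| ≤ 4 * |A * B' - B * A'| := by
    rw [abs_le]
    have h1 := key _ _ hx hy
    have h2 := key _ _ hy hx
    rw [abs_sub_comm (B * A')] at h2
    constructor <;> linarith
  rw [e]
  refine h1.trans ?_
  have e2 : A * B' - B * A' = ((A - B) - (A' - B')) * B' + (A' - B') * (B' - B) := by ring
  rw [e2]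
  have h3 := abs_add_le (((A - B) - (A' - B')) * B') ((A' - B') * (B' - B))
  rw [abs_mul, abs_mul, abs_of_nonneg (by linarith : (0:ℝ) ≤ B')] at h3
  have := mul_le_mul_of_nonneg_left hB2 (abs_nonneg ((A - B) - (A' - B')))
  linarith
end LogPot
namespace LogPot

lemma setint_bd {ν : Measure Om} [IsProbabilityMeasure ν] {f : Om → ℝ} {s : Set Om} {c : ℝ}
    (h : ∀ x ∈ s, |f x| ≤ c) : |∫ x in s, f x ∂ν| ≤ c * ν.real s :=
  norm_setIntegral_le_of_norm_le_const (f := f) (measure_lt_top ν s) h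

/-- integrand on `S n w` -/
noncomputable def hh (P : ℕ → Om → ℝ) (n : ℕ) (w x : Om) : ℝ :=
  1 + sg (w n) * (P n w - P n x)

noncomputable def Phn (ν : Measure Om) (P : ℕ → Om → ℝ) (n : ℕ) (w : Om) : ℝ :=
  ∫ x in S n w, Real.log (hh P n w x) ∂ν

noncomputable def Ph (ν : Measure Om) (P : ℕ → Om → ℝ) (w : Om) : ℝ :=
  ∑' n, Phn ν P n w

structure Good (P : ℕ → Om → ℝ) : Prop where
  meas : ∀ n, Measurable (P n)
  bd : ∀ n w, |P n w| ≤ 1/4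

lemma hh_sub (P : ℕ → Om → ℝ) (n : ℕ) (w x : Om) : |hh P n w x - 1| = |P n w - P n x| := by
  rw [hh, add_sub_cancel_left, abs_mul, abs_sg, one_mul]

lemma hh_bd {P : ℕ → Om → ℝ} (hP : Good P) (n : ℕ) (w x : Om) :
    1/2 ≤ hh P n w x ∧ hh P n w x ≤ 2 := by
  have h1 := abs_le.mp (hP.bd n w)
  have h2 := abs_le.mp (hP.bd n x)
  have h : |hh P n w x - 1| ≤ 1/2 := by
    rw [hh_sub, abs_le]; constructor <;> linarith
  have := abs_le.mp h
  constructor <;> linarith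

lemma hh_meas {P : ℕ → Om → ℝ} (hP : Good P) (n : ℕ) (w : Om) :
    Measurable (fun x => Real.log (hh P n w x)) := by
  have := hP.meas n
  unfold hh
  fun_prop

lemma log_bd {P : ℕ → Om → ℝ} (hP : Good P) (n : ℕ) (w x : Om) :
    |Real.log (hh P n w x)| ≤ 2 := by
  have h := hh_bd hP n w x
  have := log_diff h.1 (by norm_num : (1/2:ℝ) ≤ 1)
  rw [Real.log_one, sub_zero] at this
  refine this.trans ?_
  have : |hh P n w x - 1| ≤ 1 := by rw [abs_le]; constructor <;> linarith [h.1, h.2]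
  linarith

lemma hh_int {ν : Measure Om} [IsProbabilityMeasure ν] {P : ℕ → Om → ℝ} (hP : Good P)
    (n : ℕ) (w : Om) (s : Set Om) :
    IntegrableOn (fun x => Real.log (hh P n w x)) s ν :=
  Integrable.integrableOn (Integrable.of_bound (hh_meas hP n w).aestronglyMeasurable 2
    (Filter.Eventually.of_forall fun x => log_bd hP n w x))

lemma Phn_bd {ν : Measure Om} [IsProbabilityMeasure ν]
    (hν : ∀ n w, ν.real (Cyl n w) = (1/2 : ℝ) ^ n)
    {P : ℕ → Om → ℝ} (hP : Good P) (n : ℕ) (w : Om) :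
    |Phn ν P n w| ≤ 2 * (1/2) ^ (n+1) := by
  rw [← real_S hν n w]
  exact setint_bd (fun x _ => log_bd hP n w x)

lemma Phn_summable {ν : Measure Om} [IsProbabilityMeasure ν]
    (hν : ∀ n w, ν.real (Cyl n w) = (1/2 : ℝ) ^ n)
    {P : ℕ → Om → ℝ} (hP : Good P) (w : Om) :
    Summable (fun n => Phn ν P n w) := by
  refine Summable.of_norm_bounded (g := fun n : ℕ => 2 * (1/2 : ℝ) ^ (n+1)) ?_
    (fun n => Phn_bd hν hP n w)
  refine Summable.mul_left _ ?_
  exact (summable_nat_add_iff 1).mpr summable_geometric_two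

lemma main_est {ν : Measure Om} [IsProbabilityMeasure ν]
    (hν : ∀ n w, ν.real (Cyl n w) = (1/2 : ℝ) ^ n)
    {P Q : ℕ → Om → ℝ} (hP : Good P) (hQ : Good Q) {C r D : ℝ} (hC : 0 ≤ C) (hr : 0 ≤ r)
    (hD : 0 ≤ D) (hr4 : r ≤ 1/4) (hCr : C * r ≤ 1)
    (h2 : ∀ n k w w', (∀ i < n + k + 1, w i = w' i) → |Q n w - Q n w'| ≤ C * r ^ (k+1))
    (h3 : ∀ n w, |P n w - Q n w| ≤ C * r * D)
    (h4 : ∀ n k w w', (∀ i < n + k + 1, w i = w' i) →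
      |(P n w - Q n w) - (P n w' - Q n w')| ≤ C * r ^ (k+1) * D)
    (p : ℕ) (w w' : Om) (hw : ∀ i < p, w i = w' i) :
    |(Ph ν P w - Ph ν Q w) - (Ph ν P w' - Ph ν Q w')| ≤ 48 * C * r * D * (1/2) ^ p := by
  have hs : ∀ n w x, |hh P n w x - hh Q n w x| ≤ 2 * (C * r * D) := by
    intro n w x
    have e : hh P n w x - hh Q n w x = sg (w n) * ((P n w - Q n w) - (P n x - Q n x)) := by
      simp only [hh]; ring
    rw [e, abs_mul, abs_sg, one_mul]
    refine (abs_sub _ _).trans ?_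
    linarith [h3 n w, h3 n x]
  have hT : ∀ n w, |Phn ν P n w - Phn ν Q n w| ≤ 4 * (C * r * D) * (1/2) ^ (n+1) := by
    intro n w
    rw [Phn, Phn, ← integral_sub (hh_int hP n w _) (hh_int hQ n w _), ← real_S hν n w]
    refine setint_bd (fun x _ => ?_)
    refine (log_diff (hh_bd hP n w x).1 (hh_bd hQ n w x).1).trans ?_
    linarith [hs n w x]
  have e : (Ph ν P w - Ph ν Q w) - (Ph ν P w' - Ph ν Q w') =
      ∑' n, ((Phn ν P n w - Phn ν Q n w) - (Phn ν P n w' - Phn ν Q n w')) := by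
    have a1 := Phn_summable hν hP w
    have a2 := Phn_summable hν hQ w
    have a3 := Phn_summable hν hP w'
    have a4 := Phn_summable hν hQ w'
    rw [(a1.sub a2).tsum_sub (a3.sub a4), a1.tsum_sub a2, a3.tsum_sub a4]
    rfl
  rw [e]
  have := sum_bound (fun n => (Phn ν P n w - Phn ν Q n w) - (Phn ν P n w' - Phn ν Q n w')) p
    (16 * C * r * D) ?_ ?_
  · refine this.trans (le_of_eq ?_); ring
  · intro n hn
    obtain ⟨k, rfl⟩ : ∃ k, p = n + k + 1 := ⟨p - n - 1, by omega⟩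
    have hSS := S_congr hn hw
    have hk : n + k + 1 - 1 - n = k := by omega
    rw [hk]
    simp only [Phn]
    have hi : ∀ v, Integrable (fun x => Real.log (hh P n v x) - Real.log (hh Q n v x))
        (ν.restrict (S n w)) := fun v => (hh_int hP n v (S n w)).sub (hh_int hQ n v (S n w))
    rw [← hSS, ← integral_sub (hh_int hP n w _) (hh_int hQ n w _),
      ← integral_sub (hh_int hP n w' _) (hh_int hQ n w' _),
      ← integral_sub (hi w) (hi w')]
    have hb : ∀ x ∈ S n w, |(Real.log (hh P n w x) - Real.log (hh Q n w x)) -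
        (Real.log (hh P n w' x) - Real.log (hh Q n w' x))| ≤ 16 * C * r ^ (k+1) * D := by
      intro x _
      refine (log_four (hh_bd hP n w x).1 (hh_bd hQ n w x).1 (hh_bd hP n w' x).1
        (hh_bd hQ n w' x).1 (hh_bd hQ n w' x).2).trans ?_
      have hwn : w n = w' n := hw n (by omega)
      have b1 : |(hh P n w x - hh Q n w x) - (hh P n w' x - hh Q n w' x)| ≤
          C * r ^ (k+1) * D := by
        have e : (hh P n w x - hh Q n w x) - (hh P n w' x - hh Q n w' x) =
          sg (w n) * ((P n w - Q n w) - (P n w' - Q n w')) := by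
          simp only [hh, hwn]; ring
        rw [e, abs_mul, abs_sg, one_mul]
        exact h4 n k w w' hw
      have b2 : |hh Q n w' x - hh Q n w x| ≤ C * r ^ (k+1) := by
        have e : hh Q n w' x - hh Q n w x = sg (w n) * (Q n w' - Q n w) := by
          simp only [hh, hwn]; ring
        rw [e, abs_mul, abs_sg, one_mul, abs_sub_comm]
        exact h2 n k w w' hw
      have b3 := hs n w' x
      have b4 := mul_le_mul b3 b2 (abs_nonneg _) (by positivity)
      have b5 : 2 * (C * r * D) * (C * r ^ (k+1)) ≤ 2 * (C * r ^ (k+1) * D) := by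
        have : 0 ≤ C * r ^ (k+1) * D := by positivity
        nlinarith
      linarith
    refine (setint_bd hb).trans ?_
    rw [real_S hν]
    have hrk : r ^ k ≤ (1/4) ^ k := by gcongr
    have e4 : (1/4 : ℝ) ^ k = (1/2) ^ k * (1/2) ^ k := by rw [← mul_pow]; norm_num
    calc 16 * C * r ^ (k+1) * D * (1/2) ^ (n+1) = (16 * C * r * D * (1/2) ^ (n+1)) * r ^ k := by ring
      _ ≤ (16 * C * r * D * (1/2) ^ (n+1)) * (1/4) ^ k := by gcongr
      _ = _ := by rw [e4]; ring
  · intro k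
    refine (abs_sub _ _).trans ?_
    have t1 := hT (k + p) w
    have t2 := hT (k + p) w'
    have e5 : (1/2 : ℝ) ^ (k + p + 1) = (1/2) ^ p * (1/2) ^ (k+1) := by ring
    rw [e5] at t1 t2
    have : 0 ≤ C * r * D * ((1/2) ^ p * (1/2) ^ (k+1)) := by positivity
    have t3 : 16 * C * r * D * (1/2) ^ p * (1/2) ^ (k+1) =
      16 * (C * r * D * ((1/2) ^ p * (1/2) ^ (k+1))) := by ring
    rw [t3]
    linarith

end LogPot
namespace LogPot

lemma tr_congr {n p : ℕ} (h : n ≤ p) {w w' : Om} (hw : ∀ i < p, w i = w' i) :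
    tr n w = tr n w' := by
  funext i
  simp only [tr]
  split_ifs with hi
  · exact hw i (by omega)
  · rfl

lemma tr_agree (n : ℕ) (w : Om) : ∀ i < n, tr n w i = w i := by
  intro i hi; simp [tr, hi]

lemma tr_tr {n p : ℕ} (h : n ≤ p) (w : Om) : tr n (tr p w) = tr n w :=
  tr_congr h (tr_agree p w)

lemma continuous_tr (f : Om → ℝ) (n : ℕ) : Continuous (fun w => f (tr n w)) := by
  have : (fun w => f (tr n w)) =
      (fun v : Fin n → Bool => f (fun i => if h : i < n then v ⟨i, h⟩ else false)) ∘
      (fun (w : Om) (i : Fin n) => w i) := by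
    funext w
    simp only [Function.comp]
    rfl
  rw [this]
  exact continuous_of_discreteTopology.comp (by fun_prop)

lemma continuous_ite_coord (m : ℕ) {f : Om → ℝ} (hf : Continuous f) :
    Continuous (fun w : Om => if w m then f w else 0) := by
  have : (fun w : Om => if w m then f w else 0) =
      fun w => (fun b : Bool => if b then (1:ℝ) else 0) (w m) * f w := by
    funext w; cases w m <;> simp
  rw [this]
  refine Continuous.mul ?_ hf
  exact (continuous_of_discreteTopology (f := fun b : Bool => if b then (1:ℝ) else 0)).comp
    (continuous_apply (A := fun _ : ℕ => Bool) m)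

noncomputable def ell (r : ℝ) (a : ℕ × Om → ℝ) (n : ℕ) (w : Om) : ℝ :=
  r ^ n * Real.exp (a (n, tr n w))

noncomputable def tm (r : ℝ) (a : ℕ × Om → ℝ) (n k : ℕ) (w : Om) : ℝ :=
  if w (k + (n + 1)) then
    r ^ (k+1) * Real.exp (a (k + (n + 1), tr (k + (n + 1)) w) - a (n, tr n w)) else 0

noncomputable def T (r : ℝ) (a : ℕ × Om → ℝ) (n : ℕ) (w : Om) : ℝ := ∑' k, tm r a n k w

noncomputable def pt (r : ℝ) (a : ℕ × Om → ℝ) (w : Om) : ℝ :=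
  ∑' m, if w m then ell r a m w else 0

lemma exp_two_le : Real.exp 2 ≤ 9 := by
  have h := Real.exp_one_lt_d9
  have e : Real.exp 2 = Real.exp 1 * Real.exp 1 := by rw [← Real.exp_add]; norm_num
  rw [e]
  have := Real.exp_pos 1
  nlinarith

lemma exp_diff {s t : ℝ} (hs : s ≤ 2) (ht : t ≤ 2) :
    |Real.exp s - Real.exp t| ≤ 9 * |s - t| := by
  have key : ∀ s t : ℝ, s ≤ 2 → Real.exp s - Real.exp t ≤ 9 * |s - t| := by
    intro s t hs
    have h1 := Real.add_one_le_exp (t - s)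
    have e : Real.exp t = Real.exp s * Real.exp (t - s) := by rw [← Real.exp_add]; congr 1; ring
    have h2 : Real.exp s ≤ 9 := (Real.exp_le_exp.mpr hs).trans exp_two_le
    have h3 := Real.exp_pos s
    rw [e]
    have h4 := le_abs_self (s - t)
    have h5 := abs_nonneg (s - t)
    nlinarith
  rw [abs_le]
  have h1 := key s t hs
  have h2 := key t s ht
  rw [abs_sub_comm t s] at h2
  constructor <;> linarith

lemma tail_bound {f : ℕ → ℝ} {c r : ℝ} (hr : 0 ≤ r) (hr2 : r ≤ 1/2) (hc : 0 ≤ c)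
    (hf : ∀ k, |f k| ≤ c * r ^ (k+1)) (j : ℕ) (hj : ∀ k < j, f k = 0) :
    |∑' k, f k| ≤ 2 * c * r ^ (j+1) := by
  have hg : HasSum (fun k : ℕ => c * r ^ (j+1) * r ^ k) (c * r ^ (j+1) * (1 - r)⁻¹) :=
    (hasSum_geometric_of_lt_one hr (by linarith)).mul_left _
  have hb : ∀ k, |f (k + j)| ≤ c * r ^ (j+1) * r ^ k := fun k =>
    (hf (k+j)).trans (le_of_eq (by ring))
  have hs : Summable f := (summable_nat_add_iff j).mp
    (Summable.of_norm_bounded hg.summable hb)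
  rw [← hs.sum_add_tsum_nat_add j, Finset.sum_eq_zero
    (fun k hk => hj k (Finset.mem_range.mp hk)), zero_add]
  have h1 := tsum_of_norm_bounded (f := fun k => f (k + j)) hg hb
  refine h1.trans ?_
  have h2 : (1 - r)⁻¹ ≤ 2 := by
    rw [inv_le_comm₀ (by linarith) (by norm_num)]; linarith
  have := mul_le_mul_of_nonneg_left h2 (show 0 ≤ c * r ^ (j+1) by positivity)
  linarith

lemma summ_of {f : ℕ → ℝ} {c r : ℝ} (hr : 0 ≤ r) (hr2 : r ≤ 1/2)
    (hf : ∀ k, |f k| ≤ c * r ^ (k+1)) : Summable f := by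
  refine Summable.of_norm_bounded (g := fun k : ℕ => c * r ^ (k+1)) ?_ hf
  exact ((summable_nat_add_iff 1).mpr (summable_geometric_of_lt_one hr (by linarith))).mul_left _

section
variable {r : ℝ} {a b : ℕ × Om → ℝ}

lemma tm_bd (hr : 0 ≤ r) (ha : ∀ i, |a i| ≤ 1) (n k : ℕ) (w : Om) :
    |tm r a n k w| ≤ 9 * r ^ (k+1) := by
  unfold tm
  split_ifs
  · rw [abs_of_nonneg (by positivity), mul_comm]
    gcongr
    refine le_trans (Real.exp_le_exp.mpr ?_) exp_two_le
    have h1 := abs_le.mp (ha (k + (n + 1), tr (k + (n + 1)) w))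
    have h2 := abs_le.mp (ha (n, tr n w))
    linarith
  · rw [abs_zero]; positivity

lemma tm_diff (hr : 0 ≤ r) (ha : ∀ i, |a i| ≤ 1) (hb : ∀ i, |b i| ≤ 1) {D : ℝ}
    (hD : 0 ≤ D) (hab : ∀ i, |a i - b i| ≤ D) (n k : ℕ) (w : Om) :
    |tm r a n k w - tm r b n k w| ≤ 18 * D * r ^ (k+1) := by
  unfold tm
  split_ifs
  · rw [← mul_sub, abs_mul, abs_of_nonneg (by positivity : 0 ≤ r ^ (k+1)), mul_comm]
    gcongr
    have h1 := abs_le.mp (ha (k + (n + 1), tr (k + (n + 1)) w))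
    have h2 := abs_le.mp (ha (n, tr n w))
    have h3 := abs_le.mp (hb (k + (n + 1), tr (k + (n + 1)) w))
    have h4 := abs_le.mp (hb (n, tr n w))
    have h5 := abs_le.mp (hab (k + (n + 1), tr (k + (n + 1)) w))
    have h6 := abs_le.mp (hab (n, tr n w))
    refine (exp_diff (by linarith) (by linarith)).trans ?_
    have : |a (k + (n + 1), tr (k + (n + 1)) w) - a (n, tr n w) -
      (b (k + (n + 1), tr (k + (n + 1)) w) - b (n, tr n w))| ≤ 2 * D := by
      rw [abs_le]; constructor <;> linarith
    linarith
  · rw [sub_zero, abs_zero]; positivity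

lemma tm_congr {n k j : ℕ} (hj : j < k) {w w' : Om} (hw : ∀ i < n + k + 1, w i = w' i) :
    tm r a n j w = tm r a n j w' := by
  unfold tm
  rw [hw (j + (n + 1)) (by omega), tr_congr (p := n + k + 1) (by omega) hw,
    tr_congr (n := n) (p := n + k + 1) (by omega) hw]

lemma tm_cont (n k : ℕ) : Continuous (tm r a n k) := by
  unfold tm
  refine continuous_ite_coord _ ?_
  have h1 := continuous_tr (fun w => a (k + (n + 1), w)) (k + (n+1))
  have h2 := continuous_tr (fun w => a (n, w)) n
  exact continuous_const.mul (Real.continuous_exp.comp (h1.sub h2))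

lemma T_cont (hr : 0 ≤ r) (hr2 : r ≤ 1/2) (ha : ∀ i, |a i| ≤ 1) (n : ℕ) :
    Continuous (T r a n) := by
  unfold T
  refine continuous_tsum (u := fun k => 9 * r ^ (k+1)) (fun k => tm_cont n k) ?_
    (fun k w => tm_bd hr ha n k w)
  exact ((summable_nat_add_iff 1).mpr (summable_geometric_of_lt_one hr (by linarith))).mul_left _

lemma T_bd (hr : 0 ≤ r) (hr2 : r ≤ 1/2) (ha : ∀ i, |a i| ≤ 1) (n : ℕ) (w : Om) :
    |T r a n w| ≤ 18 * r := by
  have := tail_bound hr hr2 (by norm_num) (fun k => tm_bd hr ha n k w) 0 (by simp)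
  unfold T
  rw [zero_add, pow_one] at this
  linarith

lemma T_good (hr : 0 ≤ r) (hr2 : r ≤ 1/100) (ha : ∀ i, |a i| ≤ 1) : Good (T r a) where
  meas n := (T_cont hr (by linarith) ha n).measurable
  bd n w := (T_bd hr (by linarith) ha n w).trans (by linarith)

lemma T_osc (hr : 0 ≤ r) (hr2 : r ≤ 1/2) (ha : ∀ i, |a i| ≤ 1) (n k : ℕ) (w w' : Om)
    (hw : ∀ i < n + k + 1, w i = w' i) : |T r a n w - T r a n w'| ≤ 36 * r ^ (k+1) := by
  unfold T
  rw [← (summ_of hr hr2 (fun k => tm_bd hr ha n k w)).tsum_sub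
    (summ_of hr hr2 (fun k => tm_bd hr ha n k w'))]
  refine (tail_bound (c := 18) hr hr2 (by norm_num) (fun j => ?_) k (fun j hj => ?_)).trans
    (le_of_eq (by ring))
  · refine (abs_sub _ _).trans ?_
    linarith [tm_bd hr ha n j w, tm_bd hr ha n j w']
  · rw [tm_congr hj hw, sub_self]

lemma T_diff (hr : 0 ≤ r) (hr2 : r ≤ 1/2) (ha : ∀ i, |a i| ≤ 1) (hb : ∀ i, |b i| ≤ 1) {D : ℝ}
    (hD : 0 ≤ D) (hab : ∀ i, |a i - b i| ≤ D) (n : ℕ) (w : Om) :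
    |T r a n w - T r b n w| ≤ 36 * r * D := by
  unfold T
  rw [← (summ_of hr hr2 (fun k => tm_bd hr ha n k w)).tsum_sub
    (summ_of hr hr2 (fun k => tm_bd hr hb n k w))]
  refine (tail_bound (c := 18 * D) hr hr2 (by positivity) (fun j => ?_) 0 (by simp)).trans
    (le_of_eq (by ring))
  exact tm_diff hr ha hb hD hab n j w

lemma T_four (hr : 0 ≤ r) (hr2 : r ≤ 1/2) (ha : ∀ i, |a i| ≤ 1) (hb : ∀ i, |b i| ≤ 1) {D : ℝ}
    (hD : 0 ≤ D) (hab : ∀ i, |a i - b i| ≤ D) (n k : ℕ) (w w' : Om)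
    (hw : ∀ i < n + k + 1, w i = w' i) :
    |(T r a n w - T r b n w) - (T r a n w' - T r b n w')| ≤ 72 * r ^ (k+1) * D := by
  unfold T
  have s1 := summ_of hr hr2 (fun k => tm_bd hr ha n k w)
  have s2 := summ_of hr hr2 (fun k => tm_bd hr hb n k w)
  have s3 := summ_of hr hr2 (fun k => tm_bd hr ha n k w')
  have s4 := summ_of hr hr2 (fun k => tm_bd hr hb n k w')
  rw [← s1.tsum_sub s2, ← s3.tsum_sub s4, ← (s1.sub s2).tsum_sub (s3.sub s4)]
  refine (tail_bound (c := 36 * D) hr hr2 (by positivity) (fun j => ?_) k (fun j hj => ?_)).trans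
    (le_of_eq (by ring))
  · refine (abs_sub _ _).trans ?_
    linarith [tm_diff hr ha hb hD hab n j w, tm_diff hr ha hb hD hab n j w']
  · rw [tm_congr hj hw, tm_congr (a := b) hj hw, sub_self]

lemma ell_pos (hr : 0 < r) (n : ℕ) (w : Om) : 0 < ell r a n w := by unfold ell; positivity

lemma ell_le (hr : 0 < r) (ha : ∀ i, |a i| ≤ 1) (n : ℕ) (w : Om) : ell r a n w ≤ 3 * r ^ n := by
  unfold ell
  rw [mul_comm]
  gcongr
  refine (Real.exp_le_exp.mpr (abs_le.mp (ha _)).2).trans ?_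
  linarith [Real.exp_one_lt_d9]

lemma le_ell (hr : 0 < r) (ha : ∀ i, |a i| ≤ 1) (n : ℕ) (w : Om) : r ^ n / 3 ≤ ell r a n w := by
  unfold ell
  rw [div_eq_mul_inv]
  gcongr
  refine le_trans ?_ (Real.exp_le_exp.mpr (abs_le.mp (ha _)).1)
  rw [Real.exp_neg]
  gcongr
  linarith [Real.exp_one_lt_d9]

lemma pt_term_cont (m : ℕ) : Continuous (fun w : Om => if w m then ell r a m w else 0) := by
  refine continuous_ite_coord _ ?_
  have h2 := continuous_tr (fun w => a (m, w)) m
  unfold ell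
  exact continuous_const.mul (Real.continuous_exp.comp h2)

lemma pt_term_bd (hr : 0 < r) (ha : ∀ i, |a i| ≤ 1) (m : ℕ) (w : Om) :
    |if w m then ell r a m w else 0| ≤ 3 * r ^ m := by
  split_ifs
  · rw [abs_of_pos (ell_pos hr m w)]; exact ell_le hr ha m w
  · rw [abs_zero]; positivity

lemma pt_cont (hr : 0 < r) (hr2 : r ≤ 1/2) (ha : ∀ i, |a i| ≤ 1) : Continuous (pt r a) := by
  unfold pt
  refine continuous_tsum (u := fun k => 3 * r ^ k) (fun k => pt_term_cont k) ?_
    (fun k w => pt_term_bd hr ha k w)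
  exact (summable_geometric_of_lt_one hr.le (by linarith)).mul_left _

lemma pt_split (hr : 0 < r) (hr2 : r ≤ 1/2) (ha : ∀ i, |a i| ≤ 1) (n : ℕ) (w : Om) :
    pt r a w = (∑ i ∈ Finset.range n, if w i then ell r a i w else 0) +
      ell r a n w * ((if w n then 1 else 0) + T r a n w) := by
  have hs : Summable (fun m => if w m then ell r a m w else 0) :=
    Summable.of_norm_bounded (g := fun k : ℕ => 3 * r ^ k)
      ((summable_geometric_of_lt_one hr.le (by linarith)).mul_left _)
      (fun k => pt_term_bd hr ha k w)
  unfold pt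
  rw [← hs.sum_add_tsum_nat_add (n+1), Finset.sum_range_succ, add_assoc]
  congr 1
  rw [mul_add]
  congr 1
  · split_ifs <;> simp
  · unfold T
    rw [← tsum_mul_left]
    congr 1
    funext k
    unfold tm ell
    split_ifs
    · rw [Real.exp_sub]
      have := Real.exp_ne_zero (a (n, tr n w))
      field_simp
      ring
    · simp

lemma pt_diff (hr : 0 < r) (hr2 : r ≤ 1/2) (ha : ∀ i, |a i| ≤ 1) (n : ℕ) (w x : Om)
    (hx : x ∈ S n w) : pt r a w - pt r a x = sg (w n) * (ell r a n w * hh (T r a) n w x) := by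
  obtain ⟨h1, h2⟩ := hx
  have he : ∀ i ≤ n, ell r a i x = ell r a i w := by
    intro i hi; unfold ell; rw [tr_congr hi h1]
  have hsum : (∑ i ∈ Finset.range n, if x i then ell r a i x else 0) =
      ∑ i ∈ Finset.range n, if w i then ell r a i w else 0 := by
    refine Finset.sum_congr rfl (fun i hi => ?_)
    have hi := Finset.mem_range.mp hi
    rw [h1 i hi, he i hi.le]
  rw [pt_split hr hr2 ha n w, pt_split hr hr2 ha n x, hsum, he n le_rfl]
  unfold hh
  cases hw : w n <;> cases hxn : x n <;> simp_all [sg] <;> ring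

lemma abs_pt_diff (hr : 0 < r) (hr2 : r ≤ 1/100) (ha : ∀ i, |a i| ≤ 1) (n : ℕ) (w x : Om)
    (hx : x ∈ S n w) : |pt r a w - pt r a x| = ell r a n w * hh (T r a) n w x := by
  rw [pt_diff hr (by linarith) ha n w x hx, abs_mul, abs_sg, one_mul, abs_of_nonneg]
  have := (hh_bd (T_good hr.le hr2 ha) n w x).1
  have := ell_pos (a := a) hr n w
  positivity

end

noncomputable def F (ν : Measure Om) (r : ℝ) (a : ℕ × Om → ℝ) : ℕ × Om → ℝ := fun i =>
  - (2 ^ (i.1 + 1) * (Ph ν (T r a) (tr i.1 i.2) - Ph ν (T r a) (tr (i.1 - 1) i.2)))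

lemma zero_good : Good (fun _ _ => 0) := ⟨fun _ => measurable_const, fun _ _ => by norm_num⟩

lemma Ph_zero (ν : Measure Om) (w : Om) : Ph ν (fun _ _ => 0) w = 0 := by
  simp [Ph, Phn, hh]

section
variable {ν : Measure Om} [IsProbabilityMeasure ν]
  {r : ℝ} {a b : ℕ × Om → ℝ}

lemma Ph_osc (hν : ∀ n w, ν.real (Cyl n w) = (1/2 : ℝ) ^ n)
    (hr : 0 < r) (hr2 : r ≤ 1/100) (ha : ∀ i, |a i| ≤ 1)
    (p : ℕ) (w w' : Om) (hw : ∀ i < p, w i = w' i) :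
    |Ph ν (T r a) w - Ph ν (T r a) w'| ≤ 48 * 72 * r * 1 * (1/2) ^ p := by
  have h := main_est (ν := ν) (C := 72) (r := r) (D := 1) hν (T_good hr.le hr2 ha) zero_good
    (by norm_num) hr.le
    (by norm_num) (by linarith) (by linarith) (fun n k w w' _ => by
      rw [sub_zero, abs_zero]; positivity) (fun n w => by
      rw [sub_zero]; linarith [T_bd hr.le (by linarith) ha n w]) (fun n k w w' hw => by
      rw [sub_zero, sub_zero]
      have := T_osc hr.le (by linarith) ha n k w w' hw
      have : 0 ≤ r ^ (k+1) := by positivity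
      linarith) p w w' hw
  rwa [Ph_zero, Ph_zero, sub_zero, sub_zero] at h

lemma Ph_lip (hν : ∀ n w, ν.real (Cyl n w) = (1/2 : ℝ) ^ n)
    (hr : 0 < r) (hr2 : r ≤ 1/100) (ha : ∀ i, |a i| ≤ 1) (hb : ∀ i, |b i| ≤ 1)
    {D : ℝ} (hab : ∀ i, |a i - b i| ≤ D)
    (p : ℕ) (w w' : Om) (hw : ∀ i < p, w i = w' i) :
    |(Ph ν (T r a) w - Ph ν (T r b) w) - (Ph ν (T r a) w' - Ph ν (T r b) w')|
      ≤ 48 * 72 * r * D * (1/2) ^ p := by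
  have hD : 0 ≤ D := (abs_nonneg _).trans (hab (0, w))
  refine main_est (ν := ν) (C := 72) (r := r) (D := D) hν (T_good hr.le hr2 ha)
    (T_good hr.le hr2 hb)
    (by norm_num) hr.le hD (by linarith) (by linarith) (fun n k w w' hw => ?_) (fun n w => ?_)
    (fun n k w w' hw => ?_) p w w' hw
  · have := T_osc hr.le (by linarith) hb n k w w' hw
    have : 0 ≤ r ^ (k+1) := by positivity
    linarith
  · have := T_diff hr.le (by linarith) ha hb hD hab n w
    have : 0 ≤ r * D := by positivity
    linarith
  · exact T_four hr.le (by linarith) ha hb hD hab n k w w' hw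

lemma pow_aux (n : ℕ) {M : ℝ} (hM : 0 ≤ M) : 2 ^ (n+1) * (M * (1/2) ^ (n-1)) ≤ 4 * M := by
  cases n with
  | zero => simp; linarith
  | succ n =>
    rw [Nat.add_sub_cancel]
    refine le_of_eq ?_
    rw [pow_succ, pow_succ, div_pow, one_pow]
    field_simp
    ring

lemma tr_agree2 (n : ℕ) (w : Om) : ∀ i < n - 1, tr n w i = tr (n-1) w i := by
  intro i hi
  rw [tr_agree _ _ i hi, tr_agree _ _ i (by omega)]

lemma exists_fp (hν : ∀ n w, ν.real (Cyl n w) = (1/2 : ℝ) ^ n)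
    (hr : 0 < r) (hr2 : r ≤ 1/1000000) : ∃ a, (∀ i, |a i| ≤ 1) ∧ F ν r a = a := by
  refine fixed (F ν r) (fun a ha i => ?_) (fun a b ha hb D hab i => ?_)
  · have h := Ph_osc hν hr (by linarith) ha (i.1 - 1) _ _ (tr_agree2 i.1 i.2)
    rw [F, abs_neg, abs_mul, abs_of_pos (by positivity)]
    refine (mul_le_mul_of_nonneg_left h (by positivity)).trans ?_
    refine (pow_aux _ (by positivity)).trans ?_
    linarith
  · have hD : 0 ≤ D := (abs_nonneg _).trans (hab i)
    have h := Ph_lip hν hr (by linarith) ha hb hab (i.1 - 1) _ _ (tr_agree2 i.1 i.2)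
    have e : F ν r a i - F ν r b i = - (2 ^ (i.1 + 1) *
      ((Ph ν (T r a) (tr i.1 i.2) - Ph ν (T r b) (tr i.1 i.2)) -
       (Ph ν (T r a) (tr (i.1-1) i.2) - Ph ν (T r b) (tr (i.1-1) i.2)))) := by
      unfold F; ring
    rw [e, abs_neg, abs_mul, abs_of_pos (by positivity)]
    refine (mul_le_mul_of_nonneg_left h (by positivity)).trans ?_
    refine (pow_aux _ (by positivity)).trans ?_
    nlinarith

lemma potential (hν : ∀ n w, ν.real (Cyl n w) = (1/2 : ℝ) ^ n)
    (hr : 0 < r) (hr2 : r ≤ 1/100) (ha : ∀ i, |a i| ≤ 1) (hF : F ν r a = a) :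
    ∃ c, ∀ w, ∫ x, Real.log |pt r a w - pt r a x| ∂ν = c := by
  refine ⟨∑' n : ℕ, (1/2 : ℝ) ^ (n+1) * (n * Real.log r) + Ph ν (T r a) (fun _ => false),
    fun w => ?_⟩
  have hG := T_good hr.le hr2 ha
  set f : Om → ℝ := fun x => Real.log |pt r a w - pt r a x| with hf
  have hfm : Measurable f := by
    have := (pt_cont hr (by linarith) ha).measurable
    rw [hf]; fun_prop
  have hfS : ∀ n, ∀ x ∈ S n w, f x = (n * Real.log r + a (n, tr n w)) +
      Real.log (hh (T r a) n w x) := by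
    intro n x hx
    simp only [hf]
    rw [abs_pt_diff hr hr2 ha n w x hx,
      Real.log_mul (ell_pos hr n w).ne' (by linarith [(hh_bd hG n w x).1])]
    congr 1
    rw [ell, Real.log_mul (by positivity) (Real.exp_ne_zero _), Real.log_exp, Real.log_pow]
  have hval : ∀ n, ∫ x in S n w, f x ∂ν =
      (1/2 : ℝ) ^ (n+1) * (n * Real.log r) + (1/2 : ℝ) ^ (n+1) * a (n, tr n w) +
        Phn ν (T r a) n w := by
    intro n
    rw [setIntegral_congr_fun (measurableSet_S n w) (hfS n),
      integral_add (integrable_const _) (hh_int hG n w _), setIntegral_const, real_S hν, Phn,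
      smul_eq_mul]
    ring
  have hfint : ∀ n, IntegrableOn f (S n w) ν := by
    intro n
    refine IntegrableOn.congr_fun (f := fun x => (n * Real.log r + a (n, tr n w)) +
      Real.log (hh (T r a) n w x)) ?_ (fun x hx => (hfS n x hx).symm) (measurableSet_S n w)
    exact (integrable_const _).add (hh_int hG n w _)
  have hsg : Summable (fun n : ℕ => (1/2 : ℝ) ^ (n+1)) :=
    (summable_nat_add_iff 1).mpr summable_geometric_two
  have hsn : Summable (fun n : ℕ => (1/2 : ℝ) ^ (n+1) * (n * Real.log r)) := by
    have := (summable_pow_mul_geometric_of_norm_lt_one 1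
      (show ‖(1/2 : ℝ)‖ < 1 by norm_num)).mul_left (1/2 * Real.log r)
    refine this.congr (fun n => ?_)
    rw [pow_succ]; ring
  have hI : IntegrableOn f (⋃ n, S n w) ν := by
    refine integrableOn_iUnion_of_summable_integral_norm hfint ?_
    have hbs : Summable (fun n : ℕ => (1/2 : ℝ) ^ (n+1) * (n * |Real.log r|) +
        3 * (1/2 : ℝ) ^ (n+1)) := by
      refine Summable.add ?_ (hsg.mul_left _)
      refine hsn.abs.congr (fun n => ?_)
      rw [abs_mul, abs_mul, abs_of_nonneg (by positivity : (0:ℝ) ≤ (1/2)^(n+1)), Nat.abs_cast]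
    refine Summable.of_nonneg_of_le (fun n => integral_nonneg fun x => norm_nonneg _)
      (fun n => ?_) hbs
    refine (le_abs_self _).trans ?_
    refine (setint_bd (c := n * |Real.log r| + 3) ?_).trans ?_
    · intro x hx
      rw [Real.norm_eq_abs, abs_abs, hfS n x hx]
      have h1 := log_bd hG n w x
      have h2 := ha (n, tr n w)
      have h3 : |(n : ℝ) * Real.log r| = n * |Real.log r| := by rw [abs_mul, Nat.abs_cast]
      have h4 := abs_add_le ((n : ℝ) * Real.log r + a (n, tr n w)) (Real.log (hh (T r a) n w x))
      have h5 := abs_add_le ((n : ℝ) * Real.log r) (a (n, tr n w))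
      linarith
    · rw [real_S hν]
      refine le_of_eq ?_; ring
  have hres : ∫ x, f x ∂ν = ∫ x in ⋃ n, S n w, f x ∂ν := by
    rw [iUnion_S, Measure.restrict_eq_self_of_ae_mem]
    rw [ae_iff]
    simpa using null_singleton hν w
  have hsum := hasSum_integral_iUnion (fun n => measurableSet_S n w) (disj_S w) hI
  rw [hres, ← hsum.tsum_eq]
  simp_rw [hval]
  have hsa : HasSum (fun n => (1/2 : ℝ) ^ (n+1) * a (n, tr n w))
      (-(Ph ν (T r a) w - Ph ν (T r a) (fun _ => false))) := by
    have hsm : Summable (fun n => (1/2 : ℝ) ^ (n+1) * a (n, tr n w)) := by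
      refine Summable.of_norm_bounded hsg (fun n => ?_)
      rw [Real.norm_eq_abs, abs_mul, abs_of_nonneg (by positivity : (0:ℝ) ≤ (1/2)^(n+1))]
      exact mul_le_of_le_one_right (by positivity) (ha _)
    refine (hsm.hasSum_iff_tendsto_nat).mpr ?_
    rw [← Filter.tendsto_add_atTop_iff_nat 1]
    have hps : ∀ n, ∑ i ∈ Finset.range (n+1), (1/2 : ℝ) ^ (i+1) * a (i, tr i w) =
        -(Ph ν (T r a) (tr n w) - Ph ν (T r a) (fun _ => false)) := by
      have hstep : ∀ i, (1/2 : ℝ) ^ (i+1) * a (i, tr i w) =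
          -(Ph ν (T r a) (tr i w) - Ph ν (T r a) (tr (i-1) w)) := by
        intro i
        conv_lhs => rw [← hF]
        simp only [F]
        rw [tr_tr le_rfl, tr_tr (by omega)]
        have : (1/2 : ℝ) ^ (i+1) * 2 ^ (i+1) = 1 := by rw [← mul_pow]; norm_num
        linear_combination (-(Ph ν (T r a) (tr i w) - Ph ν (T r a) (tr (i-1) w))) * this
      have h0 : tr 0 w = fun _ => false := by funext i; simp [tr]
      intro n
      induction n with
      | zero => rw [Finset.sum_range_one, hstep, h0]
      | succ n ih =>
        rw [Finset.sum_range_succ, ih, hstep, Nat.add_sub_cancel]; ring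
    simp_rw [hps]
    refine Filter.Tendsto.neg (Filter.Tendsto.sub_const ?_ _)
    rw [tendsto_iff_dist_tendsto_zero]
    have hz : Filter.Tendsto (fun n : ℕ => 48 * 72 * r * 1 * (1/2 : ℝ) ^ n) Filter.atTop
        (nhds 0) := by
      have := (tendsto_pow_atTop_nhds_zero_of_lt_one
        (by norm_num : (0:ℝ) ≤ 1/2) (by norm_num)).const_mul (48 * 72 * r * 1)
      rwa [mul_zero] at this
    refine squeeze_zero (fun _ => dist_nonneg) (fun n => ?_) hz
    rw [Real.dist_eq]
    exact Ph_osc hν hr hr2 ha n _ _ (tr_agree n w)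
  have hsP := (Phn_summable hν hG w)
  rw [(hsn.add hsa.summable).tsum_add hsP, hsn.tsum_add hsa.summable, hsa.tsum_eq]
  change _ + Ph ν (T r a) w = _
  ring

end
end LogPot
namespace LogPot

section
variable {ν : Measure Om} [IsProbabilityMeasure ν]
  {r : ℝ} {a : ℕ × Om → ℝ}

lemma mem_cyl_cases (p : ℕ) (w x : Om) : x ∈ Cyl p w ∨ ∃ n < p, x ∈ S n w := by
  by_cases hx : x = w
  · left; rw [hx]; intro i _; rfl
  · have : x ∈ ⋃ n, S n w := by rw [iUnion_S]; exact hx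
    obtain ⟨n, hn⟩ := Set.mem_iUnion.mp this
    by_cases h : n < p
    · exact Or.inr ⟨n, h, hn⟩
    · left; intro i hi; exact hn.1 i (by omega)

lemma le_dist (hr : 0 < r) (hr2 : r ≤ 1/100) (ha : ∀ i, |a i| ≤ 1) {n : ℕ} {w x : Om}
    (hx : x ∈ S n w) : r ^ n / 6 ≤ |pt r a w - pt r a x| := by
  rw [abs_pt_diff hr hr2 ha n w x hx]
  have h1 := (hh_bd (T_good hr.le hr2 ha) n w x).1
  have h2 := le_ell hr ha n w
  have h3 : 0 < r ^ n := by positivity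
  nlinarith

lemma dist_le (hr : 0 < r) (hr2 : r ≤ 1/100) (ha : ∀ i, |a i| ≤ 1) {p : ℕ} {w x : Om}
    (hx : x ∈ Cyl p w) : |pt r a w - pt r a x| ≤ 6 * r ^ p := by
  by_cases hxw : x = w
  · rw [hxw, sub_self, abs_zero]; positivity
  have : x ∈ ⋃ n, S n w := by rw [iUnion_S]; exact hxw
  obtain ⟨n, hn⟩ := Set.mem_iUnion.mp this
  have hpn : p ≤ n := by
    by_contra h
    exact hn.2 (hx n (by omega))
  rw [abs_pt_diff hr hr2 ha n w x hn]
  have h1 := hh_bd (T_good hr.le hr2 ha) n w x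
  have h2 := ell_le hr ha n w
  have h3 := ell_pos (a := a) hr n w
  have h4 : r ^ n ≤ r ^ p := pow_le_pow_of_le_one hr.le (by linarith) hpn
  nlinarith

end
end LogPot

open LogPot

/-- There is `δ₁ ∈ (0,1/2)` such that for every `δ ∈ (0,δ₁)` there are a
compact set `K ⊂ ℝ×{0} ⊂ ℝ²` (identified with the real axis of `ℂ`), a Borel probability
measure `μ` with support equal to `K` (i.e. `μ(Kᶜ) = 0` and every ball around a point of `K`
has positive measure), a constant `C₀ ≥ 1` with `C₀⁻¹ ρ^δ ≤ μ(B(x,ρ)) ≤ C₀ ρ^δ` for `x ∈ K`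
and `0 < ρ ≤ diam K` (so `K` is Ahlfors regular of dimension `δ`), and a constant `c ∈ ℝ`
such that the logarithmic potential `∫_K ln|y−x| dμ(x)` equals `c` at every `y ∈ K`. -/
theorem stmt10 :
    ∃ δ₁ : ℝ, 0 < δ₁ ∧ δ₁ < 1 / 2 ∧
      ∀ δ : ℝ, 0 < δ → δ < δ₁ →
      ∃ (K : Set ℂ) (μ : Measure ℂ) (C₀ c : ℝ),
        IsCompact K ∧
        K ⊆ {z : ℂ | z.im = 0} ∧
        (∃ p ∈ K, ∃ q ∈ K, p ≠ q) ∧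
        IsProbabilityMeasure μ ∧
        μ Kᶜ = 0 ∧
        (∀ x ∈ K, ∀ ρ : ℝ, 0 < ρ → 0 < μ (Metric.ball x ρ)) ∧
        1 ≤ C₀ ∧
        (∀ x ∈ K, ∀ ρ : ℝ, 0 < ρ → ρ ≤ Metric.diam K →
          C₀⁻¹ * ρ ^ δ ≤ (μ (Metric.closedBall x ρ)).toReal ∧
          (μ (Metric.closedBall x ρ)).toReal ≤ C₀ * ρ ^ δ) ∧
        (∀ y ∈ K, ∫ x, Real.log ‖y - x‖ ∂μ = c) := by
  refine ⟨1/20, by norm_num, by norm_num, fun δ hδ hδ1 => ?_⟩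
  obtain ⟨ν, hνp, hν⟩ := exists_coin
  set r : ℝ := (2:ℝ) ^ (-(1/δ)) with hrdef
  have hr : 0 < r := by positivity
  have hr3 : r ≤ 1/1000000 := by
    have h1 : r ≤ (2:ℝ) ^ (-(20:ℝ)) := by
      refine Real.rpow_le_rpow_of_exponent_le (by norm_num) ?_
      have : 20 ≤ 1/δ := by rw [le_div_iff₀ hδ]; linarith
      linarith
    refine h1.trans ?_
    rw [Real.rpow_neg (by norm_num)]
    norm_num
  have hr2 : r ≤ 1/100 := by linarith
  have hrd : r ^ δ = 1/2 := by
    rw [hrdef, ← Real.rpow_mul (by norm_num)]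
    have : -(1/δ) * δ = -1 := by field_simp
    rw [this, Real.rpow_neg_one]; norm_num
  have hrp : ∀ p : ℕ, (r ^ p) ^ δ = (1/2 : ℝ) ^ p := by
    intro p
    rw [← Real.rpow_natCast, ← Real.rpow_mul hr.le, mul_comm, Real.rpow_mul hr.le, hrd,
      Real.rpow_natCast]
  obtain ⟨a, ha, hF⟩ := exists_fp hν hr hr3
  obtain ⟨c, hc⟩ := potential hν hr hr2 ha hF
  let g : Om → ℂ := fun w => (pt r a w : ℂ)
  have hgc : Continuous g := Complex.continuous_ofReal.comp (pt_cont hr (by linarith) ha)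
  have hgm : Measurable g := hgc.measurable
  have hgd : ∀ w x, dist (g x) (g w) = |pt r a w - pt r a x| := by
    intro w x
    rw [dist_comm, Complex.dist_eq, ← Complex.ofReal_sub, Complex.norm_real, Real.norm_eq_abs]
  have hK : IsCompact (Set.range g) := isCompact_range hgc
  have hdiam : Metric.diam (Set.range g) ≤ 6 := by
    refine Metric.diam_le_of_forall_dist_le (by norm_num) ?_
    rintro _ ⟨x, rfl⟩ _ ⟨w, rfl⟩
    rw [hgd]
    have := dist_le hr hr2 ha (p := 0) (w := w) (x := x) (fun i hi => by omega)
    simpa using this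
  have hμb : ∀ w ρ, (ν.map g (Metric.closedBall (g w) ρ)).toReal =
      ν.real {x | |pt r a w - pt r a x| ≤ ρ} := by
    intro w ρ
    rw [Measure.map_apply hgm measurableSet_closedBall, Measure.real]
    congr 2
    ext x
    simp [← hgd]
  have h6 : (1:ℝ) ≤ 6 ^ δ := Real.one_le_rpow (by norm_num) hδ.le
  refine ⟨Set.range g, ν.map g, 2 * 6 ^ δ, c, hK, ?_, ?_, ?_, ?_, ?_, ?_, ?_, ?_⟩
  · rintro _ ⟨w, rfl⟩
    exact Complex.ofReal_im _
  · refine ⟨g (fun _ => true), ⟨_, rfl⟩, g (fun _ => false), ⟨_, rfl⟩, ?_⟩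
    rw [← dist_pos, dist_comm, hgd]
    have : (fun _ => false : Om) ∈ S 0 (fun _ => true) := ⟨fun i hi => by omega, by simp⟩
    have := le_dist hr hr2 ha this
    have h1 : 0 < r ^ 0 / 6 := by positivity
    linarith
  · exact Measure.isProbabilityMeasure_map hgm.aemeasurable
  · rw [Measure.map_apply hgm hK.measurableSet.compl]
    have : g ⁻¹' (Set.range g)ᶜ = ∅ := by ext x; simp
    rw [this, measure_empty]
  · rintro _ ⟨w, rfl⟩ ρ hρ
    obtain ⟨p, hp⟩ := exists_pow_lt_of_lt_one (show 0 < ρ/6 by positivity)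
      (show r < 1 by linarith)
    rw [Measure.map_apply hgm measurableSet_ball]
    have hsub : Cyl p w ⊆ g ⁻¹' Metric.ball (g w) ρ := by
      intro x hx
      rw [Set.mem_preimage, Metric.mem_ball, hgd]
      have := dist_le hr hr2 ha hx
      linarith
    refine lt_of_lt_of_le ?_ (measure_mono hsub)
    have h1 : 0 < ν.real (Cyl p w) := by rw [hν]; positivity
    exact (ENNReal.toReal_pos_iff.mp h1).1
  · linarith
  · rintro _ ⟨w, rfl⟩ ρ hρ hρd
    rw [hμb]
    have hρ6 : ρ ≤ 6 := hρd.trans hdiam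
    constructor
    · obtain ⟨p, hp1, hp2⟩ := exists_nat_pow_near_of_lt_one (show 0 < ρ/6 by positivity)
        (show ρ/6 ≤ 1 by linarith) hr (by linarith)
      have hsub : Cyl (p+1) w ⊆ {x | |pt r a w - pt r a x| ≤ ρ} := by
        intro x hx
        have := dist_le hr hr2 ha hx
        change _ ≤ ρ
        linarith
      refine le_trans ?_ (measureReal_mono hsub)
      rw [hν]
      have h1 : (ρ/6) ^ δ ≤ (r ^ p) ^ δ := Real.rpow_le_rpow (by positivity) hp2 hδ.le
      rw [hrp, Real.div_rpow hρ.le (by norm_num)] at h1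
      have e : (2 * (6:ℝ) ^ δ)⁻¹ * ρ ^ δ = (1/2) * (ρ ^ δ / 6 ^ δ) := by
        field_simp
      rw [e, pow_succ]
      linarith
    · have hρδ : 0 < ρ ^ δ := by positivity
      have e0 : (6 * ρ) ^ δ = 6 ^ δ * ρ ^ δ := Real.mul_rpow (by norm_num) hρ.le
      by_cases h1 : 1 ≤ 6 * ρ
      · have h2 : (1:ℝ) ≤ (6 * ρ) ^ δ := Real.one_le_rpow h1 hδ.le
        rw [e0] at h2
        refine measureReal_le_one.trans ?_
        linarith
      · push Not at h1
        obtain ⟨p, hp1, hp2⟩ := exists_nat_pow_near_of_lt_one (show 0 < 6 * ρ by positivity)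
          h1.le hr (by linarith)
        have hsub : {x | |pt r a w - pt r a x| ≤ ρ} ⊆ Cyl p w := by
          intro x hx
          change _ ≤ ρ at hx
          rcases mem_cyl_cases p w x with h | ⟨n, hn, h⟩
          · exact h
          · exfalso
            have h3 := le_dist hr hr2 ha h
            have h4 : r ^ p < r ^ n := pow_lt_pow_right_of_lt_one₀ hr (by linarith) hn
            linarith
        refine (measureReal_mono hsub).trans ?_
        rw [hν]
        have h5 : (r ^ (p+1)) ^ δ ≤ (6 * ρ) ^ δ := Real.rpow_le_rpow (by positivity) hp1.le hδ.le
        rw [e0, hrp, pow_succ] at h5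
        have : 0 < (6:ℝ) ^ δ * ρ ^ δ := by positivity
        linarith
  · rintro _ ⟨w, rfl⟩
    rw [integral_map hgm.aemeasurable]
    · rw [← hc w]
      congr 1
      funext x
      rw [← hgd, dist_comm, dist_eq_norm]
    · refine Measurable.aestronglyMeasurable ?_
      fun_prop
end

section
/- There exists δ_M ∈ (0,1] such that for every δ ∈ (0, δ_M) there exist a compact set K ⊂ ℝ×{0} ⊂ ℝ² that is Ahlfors regular of dimension δ, a constant C ≥ 1, and a continuous function G : ℝ² → [0,∞) with the following properties: G(y) = 0 if and only if y ∈ K; G is harmonic on the open set ℝ² \ K; C^{−1} dist(y,K)^δ ≤ G(y) ≤ C dist(y,K)^δ for every y with 0 < dist(y,K) ≤ 1; and G(y) − ln|y| → 0 as |y| → ∞. (G is the Green function of ℝ² \ K with pole at infinity.) -/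
open MeasureTheory


namespace CantorGreen

/-- the space of digit sequences -/
abbrev Om : Type := ℕ → Bool

open PiNat

/-- fair coin -/
noncomputable def coin : Measure Bool := (PMF.uniformOfFintype Bool).toMeasure

instance : IsProbabilityMeasure coin := by unfold coin; infer_instance

/-- fair coin tossing measure -/
noncomputable def om : Measure Om := Measure.infinitePi (fun _ : ℕ => coin)

instance : IsProbabilityMeasure om := by unfold om; infer_instance

theorem coin_singleton (b : Bool) : coin {b} = 1 / 2 := by
  unfold coin
  rw [PMF.toMeasure_apply_singleton _ _ (measurableSet_singleton b)]
  simp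

theorem isClopen_cyl (s : Om) (n : ℕ) : MeasurableSet (cylinder s n) :=
  (isOpen_cylinder (fun _ => Bool) s n).measurableSet

theorem om_cyl (s : Om) (n : ℕ) : om (cylinder s n) = (1 / 2) ^ n := by
  rw [cylinder_eq_pi, om, Measure.infinitePi_pi _ (by intros; measurability)]
  simp only [coin_singleton]
  simp

theorem om_real_cyl (s : Om) (n : ℕ) : om.real (cylinder s n) = (1 / 2) ^ n := by
  rw [measureReal_def, om_cyl]; simp

theorem om_singleton (s : Om) : om {s} = 0 := by
  have h : ∀ n : ℕ, om {s} ≤ (1 / 2) ^ n := fun n => by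
    rw [← om_cyl s n]
    exact measure_mono (by simp)
  have h2 : Filter.Tendsto (fun n : ℕ => ((1 : ENNReal) / 2) ^ n) Filter.atTop (nhds 0) :=
    ENNReal.tendsto_pow_atTop_nhds_zero_of_lt_one (by simp)
  exact le_antisymm (ge_of_tendsto' h2 h) (by simp)

theorem ae_ne (s : Om) : ∀ᵐ t ∂om, t ≠ s := by
  rw [ae_iff]; simpa using om_singleton s

theorem preim_ae (s : Om) (k : ℕ) :
    (firstDiff s ⁻¹' {k}) \ {s} = (cylinder s k \ cylinder s (k + 1)) := by
  ext t
  by_cases h : t = s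
  · subst h; simp
  · have h' : s ≠ t := fun e => h e.symm
    have h1 := mem_cylinder_iff_le_firstDiff h k
    have h2 := mem_cylinder_iff_le_firstDiff h (k + 1)
    rw [firstDiff_comm] at h1 h2
    simp only [Set.mem_sdiff, Set.mem_preimage, Set.mem_singleton_iff, h, h1, h2]
    simp; omega

theorem meas_fd (s : Om) : Measurable (firstDiff s) := by
  apply measurable_to_countable'
  intro k
  have h1 : MeasurableSet ((firstDiff s ⁻¹' {k}) \ {s}) := by
    rw [preim_ae]; exact (isClopen_cyl _ _).diff (isClopen_cyl _ _)
  by_cases hs : s ∈ firstDiff s ⁻¹' {k}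
  · have : firstDiff s ⁻¹' {k} = ((firstDiff s ⁻¹' {k}) \ {s}) ∪ {s} := by
      simp [hs]
    rw [this]; exact h1.union (measurableSet_singleton s)
  · rwa [Set.sdiff_singleton_eq_self hs] at h1

theorem om_fd (s : Om) (k : ℕ) : om (firstDiff s ⁻¹' {k}) = (1 / 2) ^ (k + 1) := by
  rw [← measure_sdiff_null (s := firstDiff s ⁻¹' {k}) (om_singleton s), preim_ae,
    measure_sdiff (cylinder_anti s (Nat.le_succ k)) (isClopen_cyl _ _).nullMeasurableSet (by simp), 
    om_cyl, om_cyl]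
  have : ((1 : ENNReal) / 2) ^ k = (1 / 2) ^ (k + 1) + (1 / 2) ^ (k + 1) := by
    rw [pow_succ, ← mul_add, ENNReal.add_halves, mul_one]
  rw [this]
  exact ENNReal.add_sub_cancel_right (by simp)

/-- law of the first difference -/
noncomputable def nu : Measure ℕ := om.map (firstDiff (fun _ => false))

theorem map_fd (s : Om) : om.map (firstDiff s) = nu := by
  unfold nu
  apply Measure.ext_of_singleton
  intro k
  rw [Measure.map_apply (meas_fd _) (measurableSet_singleton _),
    Measure.map_apply (meas_fd _) (measurableSet_singleton _), om_fd, om_fd]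

theorem nu_singleton (k : ℕ) : nu {k} = (1 / 2) ^ (k + 1) := by
  unfold nu
  rw [Measure.map_apply (meas_fd _) (measurableSet_singleton _), om_fd]

theorem integrable_nu {f : ℕ → ℝ} (hf : Summable fun k => (1 / 2 : ℝ) ^ (k + 1) * |f k|) :
    Integrable f nu := by
  refine ⟨measurable_from_nat.aestronglyMeasurable, ?_⟩
  rw [hasFiniteIntegral_iff_norm, lintegral_countable']
  have : ∀ k, ENNReal.ofReal ‖f k‖ * nu {k} = ENNReal.ofReal ((1 / 2 : ℝ) ^ (k + 1) * |f k|) := by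
    intro k
    rw [nu_singleton, mul_comm, ENNReal.ofReal_mul (by positivity), ENNReal.ofReal_pow (by norm_num),
      ENNReal.ofReal_div_of_pos (by norm_num)]
    simp
  simp_rw [this]
  exact hf.tsum_ofReal_lt_top

theorem integrable_fd (s : Om) {f : ℕ → ℝ}
    (hf : Summable fun k => (1 / 2 : ℝ) ^ (k + 1) * |f k|) :
    Integrable (fun t => f (firstDiff s t)) om := by
  have := integrable_nu hf
  rw [← map_fd s] at this
  exact this.comp_measurable (meas_fd s)

theorem integral_fd (s : Om) (f : ℕ → ℝ) :
    ∫ t, f (firstDiff s t) ∂om = ∫ k, f k ∂nu := by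
  rw [← map_fd s, integral_map (meas_fd s).aemeasurable measurable_from_nat.aestronglyMeasurable]

theorem integral_nu {f : ℕ → ℝ} (hf : Summable fun k => (1 / 2 : ℝ) ^ (k + 1) * |f k|) :
    ∫ k, f k ∂nu = ∑' k, (1 / 2 : ℝ) ^ (k + 1) * f k := by
  rw [integral_countable (integrable_nu hf)]
  congr 1; ext k
  rw [measureReal_def, nu_singleton]; simp

/-- domination by a function of the first difference -/
theorem integrable_of_fd (s : Om) {h : Om → ℝ} (hm : Measurable h) {f : ℕ → ℝ}
    (hf : Summable fun k => (1 / 2 : ℝ) ^ (k + 1) * |f k|)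
    (hh : ∀ t, t ≠ s → |h t| ≤ f (firstDiff s t)) : Integrable h om := by
  refine (integrable_fd s hf).mono' hm.aestronglyMeasurable ?_
  filter_upwards [ae_ne s] with t ht using hh t ht

theorem integral_le_of_fd (s : Om) {h : Om → ℝ} (hi : Integrable h om) {f : ℕ → ℝ}
    (hf : Summable fun k => (1 / 2 : ℝ) ^ (k + 1) * |f k|)
    (hh : ∀ t, t ≠ s → h t ≤ f (firstDiff s t)) :
    ∫ t, h t ∂om ≤ ∑' k, (1 / 2 : ℝ) ^ (k + 1) * f k := by
  rw [← integral_nu hf, ← integral_fd s]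
  refine integral_mono_ae hi (integrable_fd s hf) ?_
  filter_upwards [ae_ne s] with t ht using hh t ht

end CantorGreen

namespace CantorGreen
open PiNat

/-- model dominating function of the first difference -/
noncomputable def bfun (n : ℕ) (A B D : ℝ) (k : ℕ) : ℝ :=
  if k < n then A * (1 / 4) ^ (n - k) else B + D * ((k : ℝ) - n)

theorem bfun_hasSum (n : ℕ) (A B D : ℝ) :
    HasSum (fun k => (1 / 2 : ℝ) ^ (k + 1) * bfun n A B D k)
      ((1 / 2) ^ n * (A / 2 * (1 - (1 / 2) ^ n) + B + D)) := by
  rw [← hasSum_nat_add_iff' n]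
  have h0 : HasSum (fun k : ℕ => (1 / 2 : ℝ) ^ k) 2 := hasSum_geometric_two
  have h1 : HasSum (fun k : ℕ => (k : ℝ) * (1 / 2 : ℝ) ^ k) 2 := by
    have := hasSum_coe_mul_geometric_of_norm_lt_one (𝕜 := ℝ) (r := 1 / 2) (by norm_num)
    norm_num at this ⊢
    exact this
  have h2 := (h0.mul_left ((1 / 2) ^ (n + 1) * B)).add (h1.mul_left ((1 / 2) ^ (n + 1) * D))
  have h3 : ∑ i ∈ Finset.range n, (1 / 2 : ℝ) ^ (i + 1) * bfun n A B D i
      = (1 / 2) ^ n * (A / 2 * (1 - (1 / 2) ^ n)) := by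
    have : ∀ i ∈ Finset.range n, (1 / 2 : ℝ) ^ (i + 1) * bfun n A B D i
        = A * (1 / 4) ^ n / 2 * 2 ^ i := by
      intro i hi
      have hi := Finset.mem_range.1 hi
      obtain ⟨j, rfl⟩ := Nat.exists_eq_add_of_lt hi
      have e : i + j + 1 - i = j + 1 := by omega
      simp only [bfun, hi, if_true, e]
      have : (2 : ℝ) ^ i = (1 / 2) ^ i * 4 ^ i := by rw [← mul_pow]; norm_num
      rw [this]
      have h4 : (1 / 4 : ℝ) ^ i * 4 ^ i = 1 := by rw [← mul_pow]; norm_num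
      rw [show i + j + 1 = i + (j + 1) by ring, pow_add (1 / 4 : ℝ) i]
      linear_combination (-(1/2) ^ i / 2 * A * (1 / 4) ^ (j + 1)) * h4
    rw [Finset.sum_congr rfl this, ← Finset.mul_sum, geom_sum_eq (by norm_num)]
    have h5 : (1 / 4 : ℝ) ^ n = (1 / 2) ^ n * (1 / 2) ^ n := by rw [← mul_pow]; norm_num
    have h6 : (1 / 2 : ℝ) ^ n * 2 ^ n = 1 := by rw [← mul_pow]; norm_num
    rw [h5]
    linear_combination (A / 2 * (1 / 2) ^ n) * h6
  rw [h3]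
  have e1 : (fun k => (1 / 2 : ℝ) ^ (k + n + 1) * bfun n A B D (k + n)) =
      fun b : ℕ => (1 / 2) ^ (n + 1) * B * (1 / 2) ^ b + (1 / 2) ^ (n + 1) * D * (b * (1 / 2) ^ b) := by
    ext k
    have : ¬ (k + n < n) := by omega
    simp only [bfun, this, if_false]
    push_cast
    ring
  rw [e1]
  have e2 : (1 / 2 : ℝ) ^ n * (A / 2 * (1 - (1 / 2) ^ n) + B + D)
      - (1 / 2) ^ n * (A / 2 * (1 - (1 / 2) ^ n)) =
      (1 / 2) ^ (n + 1) * B * 2 + (1 / 2) ^ (n + 1) * D * 2 := by ring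
  rw [e2]
  exact h2

theorem bfun_summable (n : ℕ) (A B D : ℝ) :
    Summable (fun k => (1 / 2 : ℝ) ^ (k + 1) * |bfun n A B D k|) := by
  have := (bfun_hasSum n A B D).summable.abs
  refine this.congr fun k => ?_
  rw [abs_mul, abs_of_nonneg (by positivity : (0:ℝ) ≤ (1 / 2) ^ (k + 1))]

theorem integrable_of_bfun (s : Om) {h : Om → ℝ} (hm : Measurable h) {n : ℕ} {A B D : ℝ}
    (hh : ∀ t, t ≠ s → |h t| ≤ bfun n A B D (firstDiff s t)) : Integrable h om :=
  integrable_of_fd s hm (bfun_summable n A B D) hh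

theorem integral_le_of_bfun (s : Om) {h : Om → ℝ} (hi : Integrable h om) {n : ℕ} {A B D : ℝ}
    (hA : 0 ≤ A)
    (hh : ∀ t, t ≠ s → h t ≤ bfun n A B D (firstDiff s t)) :
    ∫ t, h t ∂om ≤ (1 / 2) ^ n * (A / 2 + B + D) := by
  refine (integral_le_of_fd s hi (bfun_summable n A B D) hh).trans ?_
  rw [(bfun_hasSum n A B D).tsum_eq]
  have : (0:ℝ) ≤ (1 / 2) ^ n := by positivity
  apply mul_le_mul_of_nonneg_left _ this
  nlinarith

theorem abs_integral_le_of_bfun (s : Om) {h : Om → ℝ} (hm : Measurable h) {n : ℕ} {A B D : ℝ}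
    (hA : 0 ≤ A)
    (hh : ∀ t, t ≠ s → |h t| ≤ bfun n A B D (firstDiff s t)) :
    |∫ t, h t ∂om| ≤ (1 / 2) ^ n * (A / 2 + B + D) := by
  refine abs_integral_le_integral_abs.trans ?_
  exact integral_le_of_bfun s (integrable_of_bfun s hm hh).abs hA hh

end CantorGreen

namespace CantorGreen
open PiNat

/-- a bi-Lipschitz-type embedding of the digit space with vanishing equilibrium potential -/
structure Emb (lam c : ℝ) (X : Om → ℝ) : Prop where
  l0 : 0 < lam
  l1 : lam ≤ 1 / 10 ^ 6
  c0 : 0 < c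
  cont : Continuous X
  lower : ∀ s t, s ≠ t → c * lam ^ firstDiff s t ≤ |X s - X t|
  upper : ∀ s t, s ≠ t → |X s - X t| ≤ 10 * c * lam ^ firstDiff s t
  pot : ∀ s, ∫ t, Real.log |X s - X t| ∂om = 0

theorem exists_scale {lam E d : ℝ} (h0 : 0 < lam) (h1 : lam < 1) (hd : 0 < d) :
    ∃ n : ℕ, E * lam ^ n ≤ d ∧ (n = 0 ∨ d < E * lam ^ (n - 1)) := by
  have hex : ∃ n : ℕ, E * lam ^ n ≤ d := by
    have h : Filter.Tendsto (fun n : ℕ => E * lam ^ n) Filter.atTop (nhds (E * 0)) :=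
      (tendsto_pow_atTop_nhds_zero_of_lt_one h0.le h1).const_mul E
    rw [mul_zero] at h
    exact ((h.eventually (gt_mem_nhds hd)).exists).imp fun n hn => hn.le
  classical
  refine ⟨Nat.find hex, Nat.find_spec hex, ?_⟩
  by_cases h : Nat.find hex = 0
  · exact Or.inl h
  · right
    have := Nat.find_min hex (m := Nat.find hex - 1) (by omega)
    exact not_le.1 this

/-- the potential -/
noncomputable def Gf (X : Om → ℝ) (y : ℂ) : ℝ := ∫ t, Real.log ‖y - (X t : ℂ)‖ ∂om

/-- the Cantor set -/
def KK (X : Om → ℝ) : Set ℂ := Set.range fun s => (X s : ℂ)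

variable {lam c : ℝ} {X : Om → ℝ}

theorem Emb.ne (h : Emb lam c X) {s t : Om} (hst : s ≠ t) : 0 < |X s - X t| :=
  lt_of_lt_of_le (mul_pos h.c0 (pow_pos h.l0 _)) (h.lower s t hst)

theorem Emb.l1' (h : Emb lam c X) : lam < 1 := by have := h.l1; norm_num at this; linarith

theorem Emb.isCompact (h : Emb lam c X) : IsCompact (KK X) :=
  isCompact_range (Complex.continuous_ofReal.comp h.cont)

theorem Emb.int_log (h : Emb lam c X) (s : Om) :
    Integrable (fun t => Real.log |X s - X t|) om := by
  refine integrable_of_bfun (n := 0) (A := 0) (B := |Real.log c| + Real.log 10) (D := -Real.log lam)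
    s ?_ ?_
  · have := h.cont.measurable
    fun_prop
  · intro t ht
    have hst : s ≠ t := fun e => ht e.symm
    simp only [bfun, Nat.not_lt_zero, if_false]
    have hc := h.c0
    have hl := pow_pos h.l0 (firstDiff s t)
    have e1 : Real.log (c * lam ^ firstDiff s t) = Real.log c + firstDiff s t * Real.log lam := by
      rw [Real.log_mul hc.ne' hl.ne', Real.log_pow]
    have e2 : Real.log (10 * c * lam ^ firstDiff s t) =
        Real.log 10 + Real.log c + firstDiff s t * Real.log lam := by
      rw [Real.log_mul (by positivity) hl.ne', Real.log_pow, Real.log_mul (by norm_num) hc.ne']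
    have h1 := Real.log_le_log (by positivity) (h.lower s t hst)
    have h2 := Real.log_le_log (h.ne hst) (h.upper s t hst)
    rw [e1] at h1
    rw [e2] at h2
    have h3 : Real.log lam ≤ 0 := Real.log_nonpos h.l0.le h.l1'.le
    have h4 : (0 : ℝ) ≤ firstDiff s t := by positivity
    have h5 : 0 ≤ Real.log 10 := Real.log_nonneg (by norm_num)
    have h6 := neg_abs_le (Real.log c)
    have h7 := le_abs_self (Real.log c)
    rw [abs_le]
    constructor <;> push_cast <;> nlinarith

theorem Emb.int_logy (h : Emb lam c X) {y : ℂ} (hy : y ∉ KK X) :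
    Integrable (fun t => Real.log ‖y - (X t : ℂ)‖) om := by
  have hcont : Continuous (fun t => Real.log ‖y - (X t : ℂ)‖) := by
    apply Continuous.log
    · have := h.cont
      fun_prop
    · intro t ht
      apply hy
      refine ⟨t, ?_⟩
      rw [norm_eq_zero, sub_eq_zero] at ht
      exact ht.symm
  rw [← integrableOn_univ]
  exact hcont.continuousOn.integrableOn_compact isCompact_univ

theorem norm_sub_eq (a b : ℝ) : ‖(a : ℂ) - b‖ = |a - b| := by
  rw [← Complex.ofReal_sub, Complex.norm_real, Real.norm_eq_abs]

theorem Emb.G_eq (h : Emb lam c X) {y : ℂ} (hy : y ∉ KK X) (s : Om) :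
    Gf X y = ∫ t, (Real.log ‖y - (X t : ℂ)‖ - Real.log |X s - X t|) ∂om := by
  rw [integral_sub (h.int_logy hy) (h.int_log s), h.pot s, sub_zero, Gf]

theorem pow_lam_le {lam : ℝ} (h0 : 0 < lam) (h1 : lam ≤ 1 / 10 ^ 6) {k n : ℕ} (h : k < n) :
    lam ^ n ≤ lam * 4 * (1 / 4) ^ (n - k) * lam ^ k := by
  obtain ⟨j, rfl⟩ := Nat.exists_eq_add_of_lt h
  have e : k + j + 1 - k = j + 1 := by omega
  rw [e]
  have : lam ^ j ≤ (1 / 4) ^ j := pow_le_pow_left₀ h0.le (by norm_num at h1; linarith) j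
  have h2 : lam ^ (k + j + 1) = lam * lam ^ j * lam ^ k := by ring
  have h3 : lam * 4 * (1 / 4) ^ (j + 1) * lam ^ k = lam * (1 / 4) ^ j * lam ^ k := by ring
  rw [h2, h3]
  have := pow_pos h0 k
  gcongr

theorem Emb.G_upper (h : Emb lam c X) {y : ℂ} (hy : y ∉ KK X) (s : Om) {D : ℝ} (hD : 0 ≤ D)
    {n : ℕ} (hd : ‖y - X s‖ ≤ D * (c * lam ^ n)) :
    Gf X y ≤ (1 / 2) ^ n * (D / 2 + Real.log (1 + D) + -Real.log lam) := by
  rw [h.G_eq hy s]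
  refine integral_le_of_bfun s ((h.int_logy hy).sub (h.int_log s)) hD ?_
  intro t ht
  have hst : s ≠ t := fun e => ht e.symm
  have hc := h.c0
  have hl0 := h.l0
  have hp := h.ne hst
  have hlow := h.lower s t hst
  set N := firstDiff s t with hN
  have hlN := pow_pos h.l0 N
  have hln := pow_pos h.l0 n
  have hyt : 0 < ‖y - (X t : ℂ)‖ := by
    rw [norm_pos_iff, sub_ne_zero]
    rintro rfl
    exact hy ⟨t, rfl⟩
  have htri : ‖y - (X t : ℂ)‖ ≤ ‖y - X s‖ + |X s - X t| := by
    rw [← norm_sub_eq]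
    calc ‖y - (X t : ℂ)‖ = ‖(y - X s) + (X s - X t)‖ := by congr 1; ring
      _ ≤ _ := norm_add_le _ _
  have h1 : ‖y - (X t : ℂ)‖ / |X s - X t| ≤ 1 + D * lam ^ n / lam ^ N := by
    rw [div_le_iff₀ hp]
    refine htri.trans ?_
    have : D * (c * lam ^ n) ≤ D * lam ^ n / lam ^ N * |X s - X t| := by
      calc D * (c * lam ^ n) = D * lam ^ n / lam ^ N * (c * lam ^ N) := by field_simp
        _ ≤ _ := by gcongr
    linarith
  simp only [Pi.sub_apply]
  rw [← Real.log_div hyt.ne' hp.ne']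
  have h2 := Real.log_le_log (by positivity) h1
  refine h2.trans ?_
  unfold bfun
  split_ifs with hk
  · have h3 : D * lam ^ n / lam ^ N ≤ D * (1 / 4) ^ (n - N) := by
      rw [div_le_iff₀ hlN]
      have := pow_lam_le h.l0 h.l1 hk
      have h4 : lam * 4 ≤ 1 := by have := h.l1; norm_num at this; linarith
      calc D * lam ^ n ≤ D * (lam * 4 * (1 / 4) ^ (n - N) * lam ^ N) := by gcongr
        _ ≤ D * (1 * (1 / 4) ^ (n - N) * lam ^ N) := by gcongr
        _ = _ := by ring
    have h5 : (0:ℝ) < 1 + D * lam ^ n / lam ^ N := by positivity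
    have := Real.log_le_sub_one_of_pos h5
    linarith
  · push Not at hk
    obtain ⟨j, hj⟩ := Nat.exists_eq_add_of_le hk
    have h3 : 1 + D * lam ^ n / lam ^ N ≤ (1 + D) / lam ^ j := by
      rw [hj, pow_add, le_div_iff₀ (pow_pos h.l0 j)]
      have : lam ^ j ≤ 1 := pow_le_one₀ h.l0.le h.l1'.le
      have h6 := pow_pos h.l0 j
      have : (1 + D * lam ^ n / (lam ^ n * lam ^ j)) * lam ^ j = lam ^ j + D := by field_simp
      linarith
    refine (Real.log_le_log (by positivity) h3).trans ?_
    rw [Real.log_div (by positivity) (pow_pos h.l0 j).ne', Real.log_pow, hj]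
    push_cast
    apply le_of_eq; ring

theorem Emb.G_lower (h : Emb lam c X) {y : ℂ} (hy : y ∉ KK X) (s : Om)
    (hs : ∀ t, ‖y - X s‖ ≤ ‖y - (X t : ℂ)‖)
    {n : ℕ} (hd : 80 * c * lam ^ n ≤ ‖y - X s‖)
    (hd' : n = 0 ∨ ‖y - X s‖ < 80 * c * lam ^ (n - 1)) :
    (1 / 2) ^ n * Real.log 2 ≤ Gf X y := by
  have hl2 : 1 / 2 < Real.log 2 := by have := Real.log_two_gt_d9; linarith
  have hl8 : Real.log 8 = 3 * Real.log 2 := by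
    rw [show (8:ℝ) = 2 ^ 3 by norm_num, Real.log_pow]; norm_num
  suffices hh : -Gf X y ≤ (1 / 2) ^ n * ((4 * Real.log 2) / 2 + -Real.log 8 + 0) by
    rw [hl8] at hh
    linarith
  rw [h.G_eq hy s, ← integral_neg]
  refine integral_le_of_bfun s ((h.int_logy hy).sub (h.int_log s)).neg (by linarith) ?_
  intro t ht
  have hst : s ≠ t := fun e => ht e.symm
  have hc := h.c0
  have hl0 := h.l0
  have hp := h.ne hst
  have hlow := h.lower s t hst
  have hupp := h.upper s t hst
  set N := firstDiff s t with hN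
  have hlN := pow_pos h.l0 N
  have hln := pow_pos h.l0 n
  have hds : 0 < ‖y - (X s : ℂ)‖ := lt_of_lt_of_le (by positivity) hd
  have hyt : 0 < ‖y - (X t : ℂ)‖ := hds.trans_le (hs t)
  have htri : |X s - X t| ≤ ‖y - X s‖ + ‖y - (X t : ℂ)‖ := by
    rw [← norm_sub_eq]
    calc ‖(X s : ℂ) - X t‖ = ‖(y - X t) - (y - X s)‖ := by congr 1; ring
      _ ≤ ‖y - (X t : ℂ)‖ + ‖y - X s‖ := norm_sub_le _ _
      _ = _ := add_comm _ _
  simp only [Pi.sub_apply, Pi.neg_apply, neg_sub]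
  rw [← Real.log_div hp.ne' hyt.ne']
  unfold bfun
  split_ifs with hk
  · by_cases hk1 : N + 1 = n
    · have : |X s - X t| / ‖y - (X t : ℂ)‖ ≤ 2 := by
        rw [div_le_iff₀ hyt]; have := hs t; linarith
      have h2 := Real.log_le_log (by positivity) this
      have e : n - N = 1 := by omega
      rw [e]; linarith
    · have hn0 : n ≠ 0 := by omega
      have hd2 := hd'.resolve_left hn0
      obtain ⟨m, rfl⟩ : ∃ m, n = m + 1 := ⟨n - 1, by omega⟩
      have hkm : N < m := by omega
      simp only [Nat.add_sub_cancel] at hd2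
      have h1 : |X s - X t| / ‖y - (X t : ℂ)‖ ≤ 1 + 2 * ‖y - X s‖ / |X s - X t| := by
        have h3 : |X s - X t| / 2 ≤ ‖y - (X t : ℂ)‖ := by have := hs t; linarith
        have h4 : 2 * ‖y - X s‖ / |X s - X t| = ‖y - X s‖ / (|X s - X t| / 2) := by field_simp
        rw [h4]
        have h5 : |X s - X t| / ‖y - (X t : ℂ)‖ ≤ ‖y - X s‖ / ‖y - (X t : ℂ)‖ + 1 := by
          rw [div_add_one hyt.ne']; gcongr
        have h6 : ‖y - X s‖ / ‖y - (X t : ℂ)‖ ≤ ‖y - X s‖ / (|X s - X t| / 2) := by gcongr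
        linarith
      have h2 := Real.log_le_sub_one_of_pos (x := 1 + 2 * ‖y - X s‖ / |X s - X t|) (by positivity)
      refine (Real.log_le_log (by positivity) h1).trans (h2.trans ?_)
      have h7 : 2 * ‖y - X s‖ / |X s - X t| ≤ 2 * (80 * c * lam ^ m) / (c * lam ^ N) := by gcongr
      have h8 : 2 * (80 * c * lam ^ m) / (c * lam ^ N) ≤ 160 * (lam * 4 * (1 / 4) ^ (m - N)) := by
        rw [div_le_iff₀ (by positivity)]
        have := pow_lam_le h.l0 h.l1 hkm
        calc 2 * (80 * c * lam ^ m) = 160 * c * lam ^ m := by ring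
          _ ≤ 160 * c * (lam * 4 * (1 / 4) ^ (m - N) * lam ^ N) := by gcongr
          _ = _ := by ring
      have h9 : (1 / 4 : ℝ) ^ (m + 1 - N) = (1 / 4) ^ (m - N) / 4 := by
        rw [show m + 1 - N = (m - N) + 1 by omega, pow_succ]; ring
      rw [h9]
      have h10 : (0:ℝ) < (1 / 4) ^ (m - N) := by positivity
      have h11 := h.l1
      norm_num at h11
      nlinarith
  · push Not at hk
    rw [zero_mul, add_zero]
    have h1 : |X s - X t| / ‖y - (X t : ℂ)‖ ≤ 8⁻¹ := by
      rw [div_le_iff₀ hyt]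
      have h2 : lam ^ N ≤ lam ^ n := pow_le_pow_of_le_one h.l0.le h.l1'.le hk
      have h3 : 10 * c * lam ^ N ≤ 10 * c * lam ^ n := by gcongr
      have := hs t
      linarith
    have := Real.log_le_log (by positivity) h1
    rwa [Real.log_inv] at this

end CantorGreen

namespace CantorGreen
open PiNat

variable {lam c : ℝ} {X : Om → ℝ}

theorem Emb.exists_nearest (h : Emb lam c X) (y : ℂ) :
    ∃ s, Metric.infDist y (KK X) = ‖y - X s‖ ∧ ∀ t, ‖y - X s‖ ≤ ‖y - (X t : ℂ)‖ := by
  obtain ⟨p, ⟨s, rfl⟩, hs⟩ := h.isCompact.exists_infDist_eq_dist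
    ⟨_, ⟨fun _ => false, rfl⟩⟩ y
  rw [dist_eq_norm] at hs
  refine ⟨s, hs, fun t => ?_⟩
  rw [← hs, ← dist_eq_norm]
  exact Metric.infDist_le_dist_of_mem ⟨t, rfl⟩

theorem Emb.local_re (h : Emb lam c X) {y₀ : ℂ} (hy : y₀ ∉ KK X) :
    ∃ H : ℂ → ℂ, AnalyticAt ℂ H y₀ ∧ ∀ᶠ y in nhds y₀, Gf X y = (H y).re := by
  obtain ⟨s, -, hs⟩ := h.exists_nearest y₀
  set r := ‖y₀ - X s‖ with hr
  have hr0 : 0 < r := by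
    rw [hr, norm_pos_iff, sub_ne_zero]
    rintro rfl
    exact hy ⟨s, rfl⟩
  have hX := h.cont
  have hne : ∀ t, y₀ - (X t : ℂ) ≠ 0 := fun t => norm_pos_iff.1 (hr0.trans_le (hs t))
  set z : ℂ → Om → ℂ := fun y t => (y - y₀) / (y₀ - X t) with hz
  have hzn : ∀ y ∈ Metric.ball y₀ (r / 2), ∀ t, ‖z y t‖ ≤ 1 / 2 := by
    intro y hy t
    rw [hz, norm_div, div_le_iff₀ (hr0.trans_le (hs t))]
    rw [mem_ball_iff_norm] at hy
    have := hs t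
    linarith
  have hsl : ∀ y ∈ Metric.ball y₀ (r / 2), ∀ t, 1 + z y t ∈ Complex.slitPlane := fun y hy t =>
    Complex.mem_slitPlane_of_norm_lt_one (by have := hzn y hy t; linarith)
  have hzc : ∀ y, Continuous (z y) := fun y => by
    refine Continuous.div (by fun_prop) (by fun_prop) hne
  set F : ℂ → Om → ℂ := fun y t => Complex.log (1 + z y t) with hF
  set F' : ℂ → Om → ℂ := fun y t => (1 / (y₀ - X t)) / (1 + z y t) with hF'
  have hFc : ∀ y ∈ Metric.ball y₀ (r / 2), Continuous (F y) := fun y hy =>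
    (continuous_const.add (hzc y)).clog (hsl y hy)
  have hFi : ∀ y ∈ Metric.ball y₀ (r / 2), Integrable (F y) om := fun y hy => by
    rw [← integrableOn_univ]
    exact (hFc y hy).continuousOn.integrableOn_compact isCompact_univ
  have hd : DifferentiableOn ℂ (fun y => ∫ t, F y t ∂om) (Metric.ball y₀ (r / 2)) := by
    intro y hy
    have hnh : Metric.ball y₀ (r / 2) ∈ nhds y := Metric.isOpen_ball.mem_nhds hy
    refine (hasDerivAt_integral_of_dominated_loc_of_deriv_le (F := F) (F' := F')
      (bound := fun _ => 2 / r) hnh ?_ (hFi y hy) ?_ ?_ (integrable_const _) ?_).2.differentiableAt.differentiableWithinAt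
    · filter_upwards [hnh] with x hx using (hFc x hx).aestronglyMeasurable
    · apply Continuous.aestronglyMeasurable
      refine Continuous.div ?_ (continuous_const.add (hzc y)) 
        (fun t => Complex.slitPlane_ne_zero (hsl y hy t))
      exact continuous_const.div (by fun_prop) hne
    · refine Filter.Eventually.of_forall fun t x hx => ?_
      rw [hF', norm_div, norm_div, norm_one]
      have h1 := hzn x hx t
      have h2 : 1 / 2 ≤ ‖1 + z x t‖ := by
        have := norm_sub_norm_le (1 : ℂ) (-z x t)
        rw [sub_neg_eq_add, norm_neg, norm_one] at this
        linarith
      calc 1 / ‖y₀ - (X t : ℂ)‖ / ‖1 + z x t‖ ≤ 1 / r / (1 / 2) := by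
            have := hs t
            gcongr
        _ = 2 / r := by field_simp
    · refine Filter.Eventually.of_forall fun t x hx => ?_
      have h1 : HasDerivAt (fun x => 1 + z x t) (1 / (y₀ - X t)) x := by
        simp only [hz]
        exact (((hasDerivAt_id x).sub_const y₀).div_const _).const_add 1
      exact h1.clog (hsl x hx t)
  have hball : Metric.ball y₀ (r / 2) ∈ nhds y₀ := Metric.ball_mem_nhds _ (by positivity)
  refine ⟨fun y => (Gf X y₀ : ℂ) + ∫ t, F y t ∂om,
    analyticAt_const.add (hd.analyticAt hball), ?_⟩
  filter_upwards [hball] with y hy'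
  have e : (∫ t, F y t ∂om).re = ∫ t, (F y t).re ∂om := (integral_re (hFi y hy')).symm
  rw [Complex.add_re, Complex.ofReal_re, e, Gf, Gf, ← integral_add (h.int_logy hy)]
  · congr 1; ext t
    rw [hF, Complex.log_re, ← Real.log_mul (norm_pos_iff.2 (hne t)).ne'
      (norm_pos_iff.2 (Complex.slitPlane_ne_zero (hsl y hy' t))).ne', ← norm_mul]
    congr 2
    have := hne t
    simp only [hz]
    field_simp
    ring
  · exact (hFi y hy').re

theorem Emb.smooth (h : Emb lam c X) : ContDiffOn ℝ (⊤ : ℕ∞) (Gf X) (KK X)ᶜ := by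
  intro y hy
  obtain ⟨H, hH, he⟩ := h.local_re hy
  have h1 : ContDiffAt ℝ (⊤ : ℕ∞) H y := hH.contDiffAt.restrict_scalars ℝ
  have h2 : ContDiffAt ℝ (⊤ : ℕ∞) (fun y => (H y).re) y :=
    Complex.reCLM.contDiff.contDiffAt.comp y h1
  exact (h2.congr_of_eventuallyEq he).contDiffWithinAt

theorem Emb.laplace (h : Emb lam c X) : ∀ y ∈ (KK X)ᶜ,
    iteratedFDeriv ℝ 2 (Gf X) y ![1, 1] +
      iteratedFDeriv ℝ 2 (Gf X) y ![Complex.I, Complex.I] = 0 := by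
  intro y hy
  obtain ⟨H, hH, he⟩ := h.local_re hy
  have h1 := hH.harmonicAt_re
  have h2 := (InnerProductSpace.harmonicAt_congr_nhds he).2 h1
  have h3 := h2.2.self_of_nhds
  rw [InnerProductSpace.laplacian_eq_iteratedFDeriv_complexPlane] at h3
  exact h3

theorem Emb.G_zero (h : Emb lam c X) (s : Om) : Gf X (X s) = 0 := by
  unfold Gf
  simp_rw [norm_sub_eq]
  exact h.pot s

theorem Emb.dist_pos (h : Emb lam c X) {y : ℂ} (hy : y ∉ KK X) : 0 < Metric.infDist y (KK X) := by
  rw [← h.isCompact.isClosed.notMem_iff_infDist_pos ⟨_, ⟨fun _ => false, rfl⟩⟩]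
  exact hy

theorem Emb.G_pos (h : Emb lam c X) {y : ℂ} (hy : y ∉ KK X) : 0 < Gf X y := by
  obtain ⟨s, h1, h2⟩ := h.exists_nearest y
  have hd := h.dist_pos hy
  rw [h1] at hd
  obtain ⟨n, hn, hn'⟩ := exists_scale (E := 80 * c) h.l0 h.l1' hd
  have := h.G_lower hy s h2 hn hn'
  have h4 : 0 < Real.log 2 := Real.log_pos (by norm_num)
  have : 0 < (1 / 2 : ℝ) ^ n * Real.log 2 := by positivity
  linarith

theorem Emb.G_nonneg (h : Emb lam c X) (y : ℂ) : 0 ≤ Gf X y := by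
  by_cases hy : y ∈ KK X
  · obtain ⟨s, rfl⟩ := hy
    exact (h.G_zero s).ge
  · exact (h.G_pos hy).le

theorem Emb.G_iff (h : Emb lam c X) (y : ℂ) : Gf X y = 0 ↔ y ∈ KK X := by
  constructor
  · intro h0
    by_contra hy
    exact (h.G_pos hy).ne' h0
  · rintro ⟨s, rfl⟩
    exact h.G_zero s

theorem lam_pow_rpow {lam δ : ℝ} (h0 : 0 < lam) (hδ : lam ^ δ = 1 / 2) (n : ℕ) :
    (lam ^ n) ^ δ = (1 / 2) ^ n := by
  rw [← Real.rpow_natCast, ← Real.rpow_mul h0.le, mul_comm, Real.rpow_mul h0.le, hδ,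
    Real.rpow_natCast]

theorem Emb.G_bounds (h : Emb lam c X) {δ : ℝ} (hδ0 : 0 < δ) (hδ : lam ^ δ = 1 / 2) :
    ∃ C : ℝ, 1 ≤ C ∧ ∀ y : ℂ, 0 < Metric.infDist y (KK X) → Metric.infDist y (KK X) ≤ 1 →
      C⁻¹ * Metric.infDist y (KK X) ^ δ ≤ Gf X y ∧ Gf X y ≤ C * Metric.infDist y (KK X) ^ δ := by
  have hl0 := h.l0
  have hc := h.c0
  have hlog2 : 1 / 2 < Real.log 2 := by have := Real.log_two_gt_d9; linarith
  set D : ℝ := max 1 c⁻¹ with hD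
  have hD1 : 1 ≤ D := le_max_left _ _
  have hDc : 1 ≤ D * c := by
    calc 1 = c⁻¹ * c := by field_simp
      _ ≤ D * c := by gcongr; exact le_max_right _ _
  set M : ℝ := D / 2 + Real.log (1 + D) + -Real.log lam with hM
  have hM0 : 0 < M := by
    have h1 := Real.log_pos (by linarith : 1 < 1 + D)
    have h2 := Real.log_nonpos h.l0.le h.l1'.le
    rw [hM]; linarith
  set C1 : ℝ := 4 * max 1 ((80 * c) ^ δ) with hC1
  have hC1' : 4 ≤ C1 := by rw [hC1]; linarith [le_max_left 1 ((80 * c) ^ δ)]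
  have hC1'' : 4 * (80 * c) ^ δ ≤ C1 := by rw [hC1]; linarith [le_max_right 1 ((80 * c) ^ δ)]
  set C2 : ℝ := 2 * M with hC2
  refine ⟨max C1 C2, le_trans (by linarith) (le_max_left _ _), ?_⟩
  intro y hpos hle
  have hy : y ∉ KK X := fun hy => by
    rw [Metric.infDist_zero_of_mem hy] at hpos; exact hpos.false
  obtain ⟨s, h1, h2⟩ := h.exists_nearest y
  rw [h1] at hpos hle ⊢
  set d := ‖y - (X s : ℂ)‖ with hd
  have hdδ : 0 < d ^ δ := Real.rpow_pos_of_pos hpos _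
  constructor
  · obtain ⟨n, hn, hn'⟩ := exists_scale (E := 80 * c) h.l0 h.l1' hpos
    have h3 := h.G_lower hy s h2 hn hn'
    have h4 : d ^ δ ≤ C1 * ((1 / 2) ^ n * (1 / 2)) := by
      rcases hn' with rfl | hn'
      · have : d ^ δ ≤ 1 := Real.rpow_le_one hpos.le hle hδ0.le
        simp; linarith
      · rcases Nat.eq_zero_or_pos n with rfl | hn0
        · have : d ^ δ ≤ 1 := Real.rpow_le_one hpos.le hle hδ0.le
          simp; linarith
        obtain ⟨m, rfl⟩ : ∃ m, n = m + 1 := ⟨n - 1, by omega⟩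
        simp only [Nat.add_sub_cancel] at hn'
        calc d ^ δ ≤ (80 * c * lam ^ m) ^ δ := Real.rpow_le_rpow hpos.le hn'.le hδ0.le
          _ = (80 * c) ^ δ * (1 / 2) ^ m := by
            rw [Real.mul_rpow (by positivity) (by positivity), lam_pow_rpow hl0 hδ]
          _ = 4 * (80 * c) ^ δ * ((1 / 2) ^ (m + 1) * (1 / 2)) := by ring
          _ ≤ _ := by gcongr
    rw [inv_mul_le_iff₀ (lt_of_lt_of_le (by linarith) (le_max_left C1 C2))]
    calc d ^ δ ≤ C1 * ((1 / 2) ^ n * (1 / 2)) := h4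
      _ ≤ C1 * ((1 / 2) ^ n * Real.log 2) := by gcongr
      _ ≤ C1 * Gf X y := by gcongr
      _ ≤ _ := by gcongr; exact h.G_nonneg y; exact le_max_left _ _
  · have key : ∃ n : ℕ, d ≤ D * (c * lam ^ n) ∧ D * c * lam ^ (n + 1) ≤ d := by
      obtain ⟨n, hn, hn'⟩ := exists_scale (E := D * c) h.l0 h.l1' hpos
      rcases Nat.eq_zero_or_pos n with rfl | hn0
      · refine ⟨0, by simp; linarith, ?_⟩
        rw [pow_zero, mul_one] at hn
        have := h.l1'
        simp only [zero_add, pow_one]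
        nlinarith
      · refine ⟨n - 1, ?_, ?_⟩
        · have := hn'.resolve_left (by omega)
          linarith
        · rwa [Nat.sub_add_cancel hn0]
    obtain ⟨n, hn, hn'⟩ := key
    have h3 := h.G_upper hy s (by linarith : 0 ≤ D) hn
    have h4 : (1 / 2) ^ (n + 1) ≤ d ^ δ := by
      calc (1 / 2 : ℝ) ^ (n + 1) = (lam ^ (n + 1)) ^ δ := (lam_pow_rpow hl0 hδ _).symm
        _ ≤ (D * c * lam ^ (n + 1)) ^ δ := by
          apply Real.rpow_le_rpow (by positivity) _ hδ0.le
          have := pow_pos hl0 (n + 1)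
          nlinarith
        _ ≤ d ^ δ := Real.rpow_le_rpow (by positivity) hn' hδ0.le
    calc Gf X y ≤ (1 / 2) ^ n * M := h3
      _ = C2 * (1 / 2) ^ (n + 1) := by rw [hC2]; ring
      _ ≤ C2 * d ^ δ := by gcongr
      _ ≤ _ := by gcongr; exact le_max_right _ _

theorem Emb.G_cont (h : Emb lam c X) {δ : ℝ} (hδ0 : 0 < δ) (hδ : lam ^ δ = 1 / 2) :
    Continuous (Gf X) := by
  rw [continuous_iff_continuousAt]
  intro y
  by_cases hy : y ∈ KK X
  · obtain ⟨C, hC1, hC⟩ := h.G_bounds hδ0 hδ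
    have h0 : Gf X y = 0 := (h.G_iff y).2 hy
    have hd0 : Metric.infDist y (KK X) = 0 := Metric.infDist_zero_of_mem hy
    rw [ContinuousAt, h0]
    have hcd : Continuous fun x => Metric.infDist x (KK X) := Metric.continuous_infDist_pt _
    have hlim : Filter.Tendsto (fun x => C * Metric.infDist x (KK X) ^ δ) (nhds y) (nhds 0) := by
      have : Continuous fun x => C * Metric.infDist x (KK X) ^ δ :=
        continuous_const.mul (hcd.rpow_const fun _ => Or.inr hδ0.le)
      have := this.tendsto y
      simpa [hd0, Real.zero_rpow hδ0.ne'] using this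
    refine tendsto_of_tendsto_of_tendsto_of_le_of_le' tendsto_const_nhds hlim
      (Filter.Eventually.of_forall h.G_nonneg) ?_
    have : ∀ᶠ x in nhds y, Metric.infDist x (KK X) < 1 :=
      hcd.tendsto y |>.eventually (gt_mem_nhds (by rw [hd0]; norm_num))
    filter_upwards [this] with x hx
    by_cases hxK : x ∈ KK X
    · rw [(h.G_iff x).2 hxK]
      have := Real.rpow_nonneg (Metric.infDist_nonneg (x := x) (s := KK X)) δ
      positivity
    · exact (hC x (h.dist_pos hxK) hx.le).2
  · exact (h.smooth.continuousOn).continuousAt (h.isCompact.isClosed.isOpen_compl.mem_nhds hy)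

theorem Emb.G_infty (h : Emb lam c X) : Filter.Tendsto (fun y : ℂ => Gf X y - Real.log ‖y‖)
    (Filter.comap (fun y : ℂ => ‖y‖) Filter.atTop) (nhds 0) := by
  obtain ⟨R, hR⟩ := h.isCompact.isBounded.exists_norm_le
  have hR0 : 0 ≤ R := (norm_nonneg _).trans (hR _ ⟨fun _ => false, rfl⟩)
  have hn : Filter.Tendsto (fun y : ℂ => ‖y‖) (Filter.comap (fun y : ℂ => ‖y‖) Filter.atTop)
    Filter.atTop := Filter.tendsto_comap
  have hq : Filter.Tendsto (fun y : ℂ => R / ‖y‖) (Filter.comap (fun y : ℂ => ‖y‖) Filter.atTop)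
    (nhds 0) := hn.const_div_atTop R
  have hup : Filter.Tendsto (fun y : ℂ => Real.log (1 + R / ‖y‖))
      (Filter.comap (fun y : ℂ => ‖y‖) Filter.atTop) (nhds 0) := by
    have := ((hq.const_add 1).log (by norm_num))
    simpa using this
  have hlo : Filter.Tendsto (fun y : ℂ => Real.log (1 - R / ‖y‖))
      (Filter.comap (fun y : ℂ => ‖y‖) Filter.atTop) (nhds 0) := by
    have := ((hq.const_sub 1).log (by norm_num))
    simpa using this
  have hev : ∀ᶠ y in Filter.comap (fun y : ℂ => ‖y‖) Filter.atTop, R < ‖y‖ :=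
    hn.eventually (Filter.eventually_gt_atTop R)
  have hstep : ∀ y : ℂ, R < ‖y‖ → Real.log (1 - R / ‖y‖) ≤ Gf X y - Real.log ‖y‖ ∧
      Gf X y - Real.log ‖y‖ ≤ Real.log (1 + R / ‖y‖) := by
    intro y hy
    have hy0 : 0 < ‖y‖ := hR0.trans_lt hy
    have hyK : y ∉ KK X := fun hk => by have := hR y hk; linarith
    have hi := h.int_logy hyK
    have e : ∀ a : ℝ, a = ∫ _t, a ∂om := fun a => by simp
    have hlt : R / ‖y‖ < 1 := by rwa [div_lt_one hy0]
    have ep : Real.log (1 + R / ‖y‖) + Real.log ‖y‖ = Real.log (‖y‖ + R) := by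
      rw [← Real.log_mul (by positivity) hy0.ne']
      congr 1; field_simp
    have em : Real.log (1 - R / ‖y‖) + Real.log ‖y‖ = Real.log (‖y‖ - R) := by
      rw [← Real.log_mul (by linarith) hy0.ne']
      congr 1; field_simp
    constructor
    · rw [le_sub_iff_add_le, em, Gf, e (Real.log (‖y‖ - R))]
      refine integral_mono (integrable_const _) hi fun t => ?_
      apply Real.log_le_log (by linarith)
      have := norm_sub_norm_le y (X t : ℂ)
      have := hR _ ⟨t, rfl⟩
      simp only at this
      linarith
    · rw [sub_le_iff_le_add, ep, Gf, e (Real.log (‖y‖ + R))]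
      refine integral_mono hi (integrable_const _) fun t => ?_
      apply Real.log_le_log
      · rw [norm_pos_iff, sub_ne_zero]
        rintro rfl
        exact hyK ⟨t, rfl⟩
      have := norm_sub_le y (X t : ℂ)
      have := hR _ ⟨t, rfl⟩
      simp only at this
      linarith
  refine tendsto_of_tendsto_of_tendsto_of_le_of_le' hlo hup ?_ ?_
  · filter_upwards [hev] with y hy using (hstep y hy).1
  · filter_upwards [hev] with y hy using (hstep y hy).2

end CantorGreen

namespace CantorGreen
open PiNat

variable {lam c : ℝ} {X : Om → ℝ}

theorem Emb.ahlfors (h : Emb lam c X) {δ : ℝ} (hδ0 : 0 < δ) (hδ : lam ^ δ = 1 / 2) :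
    ∃ (μ : Measure ℂ) (C₀ : ℝ), 1 ≤ C₀ ∧ μ (KK X)ᶜ = 0 ∧ μ ≠ 0 ∧
      ∀ x ∈ KK X, ∀ ρ : ℝ, 0 < ρ → ρ ≤ Metric.diam (KK X) →
        C₀⁻¹ * ρ ^ δ ≤ (μ (Metric.closedBall x ρ)).toReal ∧
        (μ (Metric.closedBall x ρ)).toReal ≤ C₀ * ρ ^ δ := by
  have hl0 := h.l0
  have hc := h.c0
  have hm : Measurable fun s => (X s : ℂ) := (Complex.continuous_ofReal.comp h.cont).measurable
  have hprob : IsProbabilityMeasure (om.map fun s => (X s : ℂ)) :=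
    Measure.isProbabilityMeasure_map hm.aemeasurable
  have hpos : 0 < (10 * c) ^ δ := Real.rpow_pos_of_pos (by positivity) _
  have hpos' : 0 < (c ^ δ)⁻¹ := inv_pos.2 (Real.rpow_pos_of_pos (by positivity) _)
  set C₀ : ℝ := 1 + 2 * (10 * c) ^ δ + (c ^ δ)⁻¹ with hC₀
  refine ⟨om.map fun s => (X s : ℂ), C₀, by linarith, ?_, hprob.ne_zero, ?_⟩
  · rw [Measure.map_apply hm h.isCompact.isClosed.measurableSet.compl]
    have : (fun s => (X s : ℂ)) ⁻¹' (KK X)ᶜ = ∅ := by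
      ext s
      simp [KK]
    rw [this, measure_empty]
  rintro x ⟨s, rfl⟩ ρ hρ hρd
  have hdiam : Metric.diam (KK X) ≤ 10 * c := by
    refine Metric.diam_le_of_forall_dist_le (by positivity) ?_
    rintro _ ⟨a, rfl⟩ _ ⟨b, rfl⟩
    simp only [dist_eq_norm, norm_sub_eq]
    by_cases hab : a = b
    · subst hab; simp; positivity
    · refine (h.upper a b hab).trans ?_
      have : lam ^ firstDiff a b ≤ 1 := pow_le_one₀ hl0.le h.l1'.le
      nlinarith
  rw [Measure.map_apply hm Metric.isClosed_closedBall.measurableSet, ← measureReal_def]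
  set S : Set Om := (fun s => (X s : ℂ)) ⁻¹' Metric.closedBall (X s : ℂ) ρ with hS
  have hmem : ∀ t, t ∈ S ↔ |X s - X t| ≤ ρ := fun t => by
    rw [hS, Set.mem_preimage, mem_closedBall_iff_norm, norm_sub_eq, abs_sub_comm]
  constructor
  · obtain ⟨n, hn, hn'⟩ := exists_scale (E := 10 * c) h.l0 h.l1' hρ
    have hsub : cylinder s n ⊆ S := by
      intro t ht
      rw [hmem]
      by_cases hst : s = t
      · subst hst; simpa using hρ.le
      · refine (h.upper s t hst).trans (le_trans ?_ hn)
        rw [mem_cylinder_comm, mem_cylinder_iff_le_firstDiff hst] at ht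
        have := pow_le_pow_of_le_one hl0.le h.l1'.le ht
        gcongr 10 * c * ?_
    have h1 : (1 / 2) ^ n ≤ om.real S := by
      rw [← om_real_cyl s n]; exact measureReal_mono hsub
    have h2 : ρ ^ δ ≤ 2 * (10 * c) ^ δ * (1 / 2) ^ n := by
      rcases Nat.eq_zero_or_pos n with rfl | hn0
      · have := Real.rpow_le_rpow hρ.le (hρd.trans hdiam) hδ0.le
        simp; linarith
      · obtain ⟨m, rfl⟩ : ∃ m, n = m + 1 := ⟨n - 1, by omega⟩
        have hn'' := hn'.resolve_left (by omega)
        simp only [Nat.add_sub_cancel] at hn''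
        calc ρ ^ δ ≤ (10 * c * lam ^ m) ^ δ := Real.rpow_le_rpow hρ.le hn''.le hδ0.le
          _ = (10 * c) ^ δ * (1 / 2) ^ m := by
            rw [Real.mul_rpow (by positivity) (by positivity), lam_pow_rpow hl0 hδ]
          _ = _ := by ring
    rw [inv_mul_le_iff₀ (by linarith)]
    calc ρ ^ δ ≤ 2 * (10 * c) ^ δ * (1 / 2) ^ n := h2
      _ ≤ C₀ * (1 / 2) ^ n := by gcongr; linarith
      _ ≤ _ := by gcongr
  · obtain ⟨n, hn, hn'⟩ := exists_scale (E := c) h.l0 h.l1' hρ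
    have hsub : S ⊆ cylinder s n := by
      intro t ht
      rw [hmem] at ht
      by_cases hst : s = t
      · subst hst; simp
      · rw [mem_cylinder_comm, mem_cylinder_iff_le_firstDiff hst]
        by_contra hlt
        push Not at hlt
        have h3 := hn'.resolve_left (by omega)
        have h4 := h.lower s t hst
        have h5 : lam ^ (n - 1) ≤ lam ^ firstDiff s t :=
          pow_le_pow_of_le_one hl0.le h.l1'.le (by omega)
        have h6 : c * lam ^ (n - 1) ≤ c * lam ^ firstDiff s t := by gcongr
        linarith
    have h1 : om.real S ≤ (1 / 2) ^ n := by
      rw [← om_real_cyl s n]; exact measureReal_mono hsub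
    calc om.real S ≤ (1 / 2) ^ n := h1
      _ = (c ^ δ)⁻¹ * (c * lam ^ n) ^ δ := by
        rw [Real.mul_rpow (by positivity) (by positivity), lam_pow_rpow hl0 hδ]
        have := (Real.rpow_pos_of_pos hc δ).ne'
        field_simp
      _ ≤ (c ^ δ)⁻¹ * ρ ^ δ := by
        gcongr
      _ ≤ C₀ * ρ ^ δ := by
        have := Real.rpow_pos_of_pos hρ δ
        gcongr; linarith

theorem final (hemb : ∀ lam : ℝ, 0 < lam → lam ≤ 1 / 10 ^ 6 → ∃ c X, Emb lam c X) :
    ∃ δM : ℝ, 0 < δM ∧ δM ≤ 1 ∧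
      ∀ δ : ℝ, 0 < δ → δ < δM →
      ∃ K : Set ℂ,
        IsCompact K ∧
        K ⊆ {z : ℂ | z.im = 0} ∧
        (∃ p ∈ K, ∃ q ∈ K, p ≠ q) ∧
        (∃ (μ : Measure ℂ) (C₀ : ℝ), 1 ≤ C₀ ∧ μ Kᶜ = 0 ∧ μ ≠ 0 ∧
          ∀ x ∈ K, ∀ ρ : ℝ, 0 < ρ → ρ ≤ Metric.diam K →
            C₀⁻¹ * ρ ^ δ ≤ (μ (Metric.closedBall x ρ)).toReal ∧
            (μ (Metric.closedBall x ρ)).toReal ≤ C₀ * ρ ^ δ) ∧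
        ∃ (C : ℝ) (G : ℂ → ℝ),
          1 ≤ C ∧
          Continuous G ∧
          (∀ y, 0 ≤ G y) ∧
          (∀ y, G y = 0 ↔ y ∈ K) ∧
          ContDiffOn ℝ (⊤ : ℕ∞) G Kᶜ ∧
          (∀ y ∈ Kᶜ,
            iteratedFDeriv ℝ 2 G y ![1, 1] +
              iteratedFDeriv ℝ 2 G y ![Complex.I, Complex.I] = 0) ∧
          (∀ y : ℂ, 0 < Metric.infDist y K → Metric.infDist y K ≤ 1 →
            C⁻¹ * Metric.infDist y K ^ δ ≤ G y ∧ G y ≤ C * Metric.infDist y K ^ δ) ∧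
          Filter.Tendsto (fun y : ℂ => G y - Real.log ‖y‖)
            (Filter.comap (fun y : ℂ => ‖y‖) Filter.atTop) (nhds 0) := by
  refine ⟨1 / 20, by norm_num, by norm_num, fun δ hδ0 hδ1 => ?_⟩
  have hδ : ((1 / 2 : ℝ) ^ (1 / δ)) ^ δ = 1 / 2 := by
    rw [← Real.rpow_mul (by norm_num), one_div_mul_cancel hδ0.ne', Real.rpow_one]
  have hl : (1 / 2 : ℝ) ^ (1 / δ) ≤ 1 / 10 ^ 6 := by
    have h20 : (20 : ℝ) ≤ 1 / δ := by rw [le_div_iff₀ hδ0]; linarith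
    calc (1 / 2 : ℝ) ^ (1 / δ) ≤ (1 / 2 : ℝ) ^ (20 : ℝ) :=
          Real.rpow_le_rpow_of_exponent_ge (by norm_num) (by norm_num) h20
      _ = (1 / 2 : ℝ) ^ (20 : ℕ) := by rw [← Real.rpow_natCast]; norm_num
      _ ≤ _ := by norm_num
  obtain ⟨c, X, h⟩ := hemb _ (Real.rpow_pos_of_pos (by norm_num) _) hl
  obtain ⟨C, hC1, hC⟩ := h.G_bounds hδ0 hδ
  refine ⟨KK X, h.isCompact, ?_, ?_, h.ahlfors hδ0 hδ, C, Gf X, hC1, h.G_cont hδ0 hδ, h.G_nonneg,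
    h.G_iff, h.smooth, h.laplace, hC, h.G_infty⟩
  · rintro _ ⟨s, rfl⟩
    simp
  · refine ⟨_, ⟨fun _ => false, rfl⟩, _, ⟨fun _ => true, rfl⟩, ?_⟩
    have hne : (fun _ => false : Om) ≠ fun _ => true := fun e => by
      have := congrFun e 0
      simp at this
    have := h.ne hne
    intro e
    simp only [Complex.ofReal_inj] at e
    rw [e] at this
    simp at this

end CantorGreen

namespace CantorGreen
open PiNat

/-- sign of a digit -/
noncomputable def sg (b : Bool) : ℝ := if b then 1 else -1

/-- truncation of a digit sequence -/
def tr (m : ℕ) (s : Om) : Om := fun i => if i < m then s i else false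

/-- the `n`-th tmm of the series -/
noncomputable def tmm (lam : ℝ) (a : ℕ → Om → ℝ) (s : Om) (n : ℕ) : ℝ :=
  sg (s n) * lam ^ n * Real.exp (a n (tr n s))

/-- the point with given digits -/
noncomputable def xx (lam : ℝ) (a : ℕ → Om → ℝ) (s : Om) : ℝ := ∑' n, tmm lam a s n

theorem abs_sg (b : Bool) : |sg b| = 1 := by cases b <;> simp [sg]

theorem sg_ne {b b' : Bool} (h : b ≠ b') : sg b - sg b' = 2 * sg b := by
  cases b <;> cases b' <;> simp [sg] at h ⊢ <;> norm_num

theorem tr_eq {s t : Om} {n k : ℕ} (h : t ∈ cylinder s n) (hk : k ≤ n) : tr k t = tr k s := by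
  ext i
  simp only [tr]
  split_ifs with hi
  · rw [mem_cylinder_iff.1 h i (by omega)]
  · rfl

theorem tr_tr {k m : ℕ} (h : k ≤ m) (s : Om) : tr k (tr m s) = tr k s := by
  ext i
  simp only [tr]
  split_ifs <;> first | rfl | omega

theorem tr_mem (s : Om) (m : ℕ) : tr m s ∈ cylinder s m := by
  rw [mem_cylinder_iff]
  intro i hi
  simp [tr, hi]

theorem tr_zero (s : Om) : tr 0 s = fun _ => false := by
  ext i; simp [tr]

theorem cont_tr (g : Om → ℝ) (n : ℕ) : Continuous fun s => g (tr n s) := by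
  apply IsLocallyConstant.continuous
  rw [IsLocallyConstant.iff_exists_open]
  intro s
  refine ⟨cylinder s n, isOpen_cylinder _ s n, self_mem_cylinder s n, fun t ht => ?_⟩
  rw [tr_eq ht le_rfl]

section
variable {lam : ℝ} {a b : ℕ → Om → ℝ} {ε : ℝ}

theorem exp_bd (ha : ∀ n s, |a n s| ≤ 1) (n : ℕ) (s : Om) :
    Real.exp (a n s) ≤ 2.7183 ∧ 0.36 ≤ Real.exp (a n s) := by
  have h := abs_le.1 (ha n s)
  have h1 := Real.exp_one_lt_d9
  have h2 := Real.exp_one_gt_d9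
  constructor
  · have := Real.exp_le_exp.2 h.2
    linarith
  · have h3 := Real.exp_le_exp.2 h.1
    have h4 : (0.36 : ℝ) ≤ Real.exp (-1) := by
      rw [Real.exp_neg, le_inv_comm₀ (by norm_num) (Real.exp_pos _)]
      norm_num
      linarith
    linarith

theorem exp_lip_aux {x y : ℝ} (hx : x ≤ 1) : Real.exp x - Real.exp y ≤ 2.7183 * |x - y| := by
  have h1 := Real.exp_one_lt_d9
  have h2 := Real.exp_le_exp.2 hx
  have h3 : Real.exp y = Real.exp x * Real.exp (y - x) := by rw [← Real.exp_add]; congr 1; ring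
  have h4 := Real.add_one_le_exp (y - x)
  have h5 := Real.exp_pos x
  have h6 := le_abs_self (x - y)
  have h7 := abs_nonneg (x - y)
  rw [h3]
  nlinarith

theorem exp_lip {x y : ℝ} (hx : |x| ≤ 1) (hy : |y| ≤ 1) :
    |Real.exp x - Real.exp y| ≤ 2.7183 * |x - y| := by
  rw [abs_le]
  have h1 := exp_lip_aux (y := y) (abs_le.1 hx).2
  have h2 := exp_lip_aux (y := x) (abs_le.1 hy).2
  rw [abs_sub_comm y x] at h2
  constructor <;> linarith

theorem term_bd (h0 : 0 < lam) (ha : ∀ n s, |a n s| ≤ 1) (s : Om) (n : ℕ) :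
    |tmm lam a s n| ≤ 2.7183 * lam ^ n := by
  rw [tmm, abs_mul, abs_mul, abs_sg, one_mul, abs_of_pos (pow_pos h0 n), abs_of_pos (Real.exp_pos _),
    mul_comm]
  have := (exp_bd ha n (tr n s)).1
  have := pow_pos h0 n
  gcongr

theorem term_lip (h0 : 0 < lam) (ha : ∀ n s, |a n s| ≤ 1) (hb : ∀ n s, |b n s| ≤ 1)
    (hab : ∀ n s, |a n s - b n s| ≤ ε) (s : Om) (n : ℕ) :
    |tmm lam a s n - tmm lam b s n| ≤ 2.7183 * ε * lam ^ n := by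
  rw [tmm, tmm, ← mul_sub, abs_mul, abs_mul, abs_sg, one_mul, abs_of_pos (pow_pos h0 n), mul_comm]
  have h1 := exp_lip (ha n (tr n s)) (hb n (tr n s))
  have h2 := hab n (tr n s)
  have := pow_pos h0 n
  have h3 : |Real.exp (a n (tr n s)) - Real.exp (b n (tr n s))| ≤ 2.7183 * ε := by
    refine h1.trans ?_
    gcongr
  gcongr

theorem summable_of_bd (h0 : 0 < lam) (h1 : lam ≤ 1 / 10 ^ 6) {v : ℕ → ℝ} {M : ℝ}
    (hv : ∀ k, |v k| ≤ M * lam ^ k) : Summable v := by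
  have hl : lam < 1 := by norm_num at h1; linarith
  refine Summable.of_norm_bounded (g := fun k => M * lam ^ k)
    ((summable_geometric_of_lt_one h0.le hl).mul_left M) hv

theorem tail_bd (h0 : 0 < lam) (h1 : lam ≤ 1 / 10 ^ 6) {v : ℕ → ℝ} {M : ℝ} {n : ℕ} (hM : 0 ≤ M)
    (hz : ∀ k < n, v k = 0) (hv : ∀ k, |v k| ≤ M * lam ^ k) :
    |∑' k, v k| ≤ 1.001 * M * lam ^ n := by
  have hl : lam < 1 := by norm_num at h1; linarith
  have hs := summable_of_bd h0 h1 hv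
  rw [← hs.sum_add_tsum_nat_add n, Finset.sum_eq_zero fun i hi => hz i (Finset.mem_range.1 hi),
    zero_add]
  have hg : HasSum (fun k => M * lam ^ n * lam ^ k) (M * lam ^ n * (1 - lam)⁻¹) :=
    (hasSum_geometric_of_lt_one h0.le hl).mul_left _
  have h2 : ‖∑' k, v (k + n)‖ ≤ M * lam ^ n * (1 - lam)⁻¹ := by
    apply tsum_of_norm_bounded hg
    intro k
    rw [Real.norm_eq_abs]
    refine (hv (k + n)).trans (le_of_eq ?_)
    ring
  rw [Real.norm_eq_abs] at h2
  refine h2.trans ?_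
  have h3 : (1 - lam)⁻¹ ≤ 1.001 := by
    rw [inv_le_comm₀ (by linarith) (by norm_num)]
    norm_num at h1 ⊢
    linarith
  have : 0 ≤ M * lam ^ n := mul_nonneg hM (pow_pos h0 n).le
  nlinarith

theorem term_eq {s t : Om} {n k : ℕ} (h : t ∈ cylinder s n) (hk : k < n) :
    tmm lam a t k = tmm lam a s k := by
  rw [tmm, tmm, tr_eq h hk.le, mem_cylinder_iff.1 h k hk]

theorem diff_bd (h0 : 0 < lam) (ha : ∀ n s, |a n s| ≤ 1) (s t : Om) (k : ℕ) :
    |tmm lam a s k - tmm lam a t k| ≤ 5.4366 * lam ^ k := by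
  have h1 := term_bd h0 ha s k
  have h2 := term_bd h0 ha t k
  have := abs_sub (tmm lam a s k) (tmm lam a t k)
  linarith

theorem diff_lip (h0 : 0 < lam) (ha : ∀ n s, |a n s| ≤ 1) (hb : ∀ n s, |b n s| ≤ 1)
    (hab : ∀ n s, |a n s - b n s| ≤ ε) (s t : Om) (k : ℕ) :
    |(tmm lam a s k - tmm lam a t k) - (tmm lam b s k - tmm lam b t k)|
      ≤ 5.4366 * ε * lam ^ k := by
  have h1 := term_lip h0 ha hb hab s k
  have h2 := term_lip h0 ha hb hab t k
  have := abs_sub (tmm lam a s k - tmm lam b s k) (tmm lam a t k - tmm lam b t k)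
  rw [show (tmm lam a s k - tmm lam a t k) - (tmm lam b s k - tmm lam b t k)
    = (tmm lam a s k - tmm lam b s k) - (tmm lam a t k - tmm lam b t k) by ring]
  linarith

theorem xx_sub (h0 : 0 < lam) (h1 : lam ≤ 1 / 10 ^ 6) (ha : ∀ n s, |a n s| ≤ 1) (s t : Om) :
    xx lam a s - xx lam a t = ∑' k, (tmm lam a s k - tmm lam a t k) :=
  ((summable_of_bd h0 h1 (term_bd h0 ha s)).tsum_sub (summable_of_bd h0 h1 (term_bd h0 ha t))).symm

theorem eps_nonneg (hab : ∀ n s, |a n s - b n s| ≤ ε) : 0 ≤ ε :=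
  (abs_nonneg _).trans (hab 0 fun _ => false)

theorem xx_bd (h0 : 0 < lam) (h1 : lam ≤ 1 / 10 ^ 6) (ha : ∀ n s, |a n s| ≤ 1) {s t : Om} {n : ℕ}
    (h : t ∈ cylinder s n) : |xx lam a s - xx lam a t| ≤ 6 * lam ^ n := by
  rw [xx_sub h0 h1 ha]
  have := tail_bd h0 h1 (n := n) (by norm_num) (fun k hk => by rw [term_eq h hk, sub_self])
    (diff_bd h0 ha s t)
  have := pow_pos h0 n
  linarith

theorem xx_lip (h0 : 0 < lam) (h1 : lam ≤ 1 / 10 ^ 6) (ha : ∀ n s, |a n s| ≤ 1)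
    (hb : ∀ n s, |b n s| ≤ 1) (hab : ∀ n s, |a n s - b n s| ≤ ε) {s t : Om} {n : ℕ}
    (h : t ∈ cylinder s n) :
    |(xx lam a s - xx lam a t) - (xx lam b s - xx lam b t)| ≤ 6 * ε * lam ^ n := by
  have hε := eps_nonneg hab
  rw [xx_sub h0 h1 ha, xx_sub h0 h1 hb, ← (summable_of_bd h0 h1 (diff_bd h0 ha s t)).tsum_sub
    (summable_of_bd h0 h1 (diff_bd h0 hb s t))]
  have := tail_bd h0 h1 (n := n) (by positivity)
    (fun k hk => by rw [term_eq h hk, term_eq h hk]; ring)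
    (diff_lip h0 ha hb hab s t)
  have : 0 ≤ ε * lam ^ n := mul_nonneg hε (pow_pos h0 n).le
  linarith

/-- the remainder after the leading tmm of a difference -/
noncomputable def rest (lam : ℝ) (a : ℕ → Om → ℝ) (s t : Om) : ℝ :=
  ∑' k, if k = firstDiff s t then 0 else (tmm lam a s k - tmm lam a t k)

theorem xx_decomp (h0 : 0 < lam) (h1 : lam ≤ 1 / 10 ^ 6) (ha : ∀ n s, |a n s| ≤ 1) {s t : Om}
    (h : s ≠ t) : xx lam a s - xx lam a t = sg (s (firstDiff s t)) *
      (2 * lam ^ firstDiff s t * Real.exp (a (firstDiff s t) (tr (firstDiff s t) s)))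
      + rest lam a s t := by
  rw [xx_sub h0 h1 ha,
    (summable_of_bd h0 h1 (diff_bd h0 ha s t)).tsum_eq_add_tsum_ite (firstDiff s t), rest]
  congr 1
  have hc : t ∈ cylinder s (firstDiff s t) := by
    rw [firstDiff_comm]; exact mem_cylinder_firstDiff t s
  rw [tmm, tmm, tr_eq hc le_rfl]
  have := sg_ne (apply_firstDiff_ne h)
  linear_combination (lam ^ firstDiff s t *
    Real.exp (a (firstDiff s t) (tr (firstDiff s t) s))) * this

theorem rest_bd (h0 : 0 < lam) (h1 : lam ≤ 1 / 10 ^ 6) (ha : ∀ n s, |a n s| ≤ 1) (s t : Om) :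
    |rest lam a s t| ≤ 6 * lam ^ (firstDiff s t + 1) := by
  have hc : t ∈ cylinder s (firstDiff s t) := by
    rw [firstDiff_comm]; exact mem_cylinder_firstDiff t s
  have := tail_bd h0 h1 (n := firstDiff s t + 1) (M := 5.4366)
    (v := fun k => if k = firstDiff s t then 0 else (tmm lam a s k - tmm lam a t k)) (by norm_num)
    (fun k hk => by
      split_ifs with he
      · rfl
      · rw [term_eq hc (by omega), sub_self])
    (fun k => by
      have := pow_pos h0 k
      split_ifs
      · rw [abs_zero]; positivity
      · exact diff_bd h0 ha s t k)
  have h2 := pow_pos h0 (firstDiff s t + 1)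
  rw [rest]
  linarith

theorem rest_lip (h0 : 0 < lam) (h1 : lam ≤ 1 / 10 ^ 6) (ha : ∀ n s, |a n s| ≤ 1)
    (hb : ∀ n s, |b n s| ≤ 1) (hab : ∀ n s, |a n s - b n s| ≤ ε) (s t : Om) :
    |rest lam a s t - rest lam b s t| ≤ 6 * ε * lam ^ (firstDiff s t + 1) := by
  have hε := eps_nonneg hab
  have hc : t ∈ cylinder s (firstDiff s t) := by
    rw [firstDiff_comm]; exact mem_cylinder_firstDiff t s
  have hb' : ∀ {a : ℕ → Om → ℝ}, (∀ n s, |a n s| ≤ 1) → ∀ k,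
      |if k = firstDiff s t then 0 else (tmm lam a s k - tmm lam a t k)| ≤ 5.4366 * lam ^ k := by
    intro a ha k
    have := pow_pos h0 k
    split_ifs
    · rw [abs_zero]; positivity
    · exact diff_bd h0 ha s t k
  rw [rest, rest, ← (summable_of_bd h0 h1 (hb' ha)).tsum_sub (summable_of_bd h0 h1 (hb' hb))]
  have := tail_bd h0 h1 (n := firstDiff s t + 1) (M := 5.4366 * ε)
    (v := fun k => (if k = firstDiff s t then 0 else (tmm lam a s k - tmm lam a t k))
      - (if k = firstDiff s t then 0 else (tmm lam b s k - tmm lam b t k))) (by positivity)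
    (fun k hk => by
      split_ifs with he
      · simp
      · rw [term_eq hc (by omega), term_eq hc (by omega)]; ring)
    (fun k => by
      have := pow_pos h0 k
      split_ifs
      · rw [sub_zero, abs_zero]; positivity
      · exact diff_lip h0 ha hb hab s t k)
  have : 0 ≤ ε * lam ^ (firstDiff s t + 1) := mul_nonneg hε (pow_pos h0 _).le
  linarith

/-- relative remainder -/
noncomputable def theta (lam : ℝ) (a : ℕ → Om → ℝ) (s t : Om) : ℝ :=
  sg (s (firstDiff s t)) * rest lam a s t * Real.exp (-a (firstDiff s t) (tr (firstDiff s t) s))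
    / (2 * lam ^ firstDiff s t)

theorem sg_mul_self (b : Bool) : sg b * sg b = 1 := by cases b <;> simp [sg]

theorem theta_bd (h0 : 0 < lam) (h1 : lam ≤ 1 / 10 ^ 6) (ha : ∀ n s, |a n s| ≤ 1) (s t : Om) :
    |theta lam a s t| ≤ 9 * lam := by
  have h2 := rest_bd h0 h1 ha s t
  have hp := pow_pos h0 (firstDiff s t)
  rw [theta, abs_div, abs_mul, abs_mul, abs_sg, one_mul, abs_of_pos (Real.exp_pos _),
    abs_of_pos (by positivity : 0 < 2 * lam ^ firstDiff s t), div_le_iff₀ (by positivity)]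
  have h3 := (exp_bd (a := fun n s => -a n s) (fun n s => by rw [abs_neg]; exact ha n s)
    (firstDiff s t) (tr (firstDiff s t) s)).1
  calc _ ≤ 6 * lam ^ (firstDiff s t + 1) * 2.7183 := by gcongr
    _ = 6 * 2.7183 * (lam * lam ^ firstDiff s t) := by ring
    _ ≤ 18 * (lam * lam ^ firstDiff s t) := by gcongr; norm_num
    _ = _ := by ring

theorem theta_lip (h0 : 0 < lam) (h1 : lam ≤ 1 / 10 ^ 6) (ha : ∀ n s, |a n s| ≤ 1)
    (hb : ∀ n s, |b n s| ≤ 1) (hab : ∀ n s, |a n s - b n s| ≤ ε) (s t : Om) :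
    |theta lam a s t - theta lam b s t| ≤ 18 * lam * ε := by
  have hε := eps_nonneg hab
  have h2 := rest_bd h0 h1 hb s t
  have h2' := rest_lip h0 h1 ha hb hab s t
  rw [theta, theta]
  set N := firstDiff s t with hN
  have hp := pow_pos h0 N
  set w := tr N s
  have h3 := (exp_bd (a := fun n s => -a n s) (fun n s => by rw [abs_neg]; exact ha n s) N w).1
  have h4 : |Real.exp (-a N w) - Real.exp (-b N w)| ≤ 2.7183 * ε := by
    refine (exp_lip (by rw [abs_neg]; exact ha N w) (by rw [abs_neg]; exact hb N w)).trans ?_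
    rw [show -a N w - -b N w = -(a N w - b N w) by ring, abs_neg]
    have := hab N w
    gcongr
  have e : sg (s N) * rest lam a s t * Real.exp (-a N w) / (2 * lam ^ N)
      - sg (s N) * rest lam b s t * Real.exp (-b N w) / (2 * lam ^ N)
      = sg (s N) * ((rest lam a s t - rest lam b s t) * Real.exp (-a N w)
        + rest lam b s t * (Real.exp (-a N w) - Real.exp (-b N w))) / (2 * lam ^ N) := by ring
  rw [e, abs_div, abs_mul, abs_sg, one_mul, abs_of_pos (by positivity : 0 < 2 * lam ^ N),
    div_le_iff₀ (by positivity)]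
  refine (abs_add_le _ _).trans ?_
  rw [abs_mul, abs_mul, abs_of_pos (Real.exp_pos _)]
  have h5 : 0 ≤ ε * (lam * lam ^ N) := by positivity
  calc _ ≤ 6 * ε * lam ^ (N + 1) * 2.7183 + 6 * lam ^ (N + 1) * (2.7183 * ε) := by gcongr
    _ = 12 * 2.7183 * (ε * (lam * lam ^ N)) := by ring
    _ ≤ 36 * (ε * (lam * lam ^ N)) := by gcongr; norm_num
    _ = _ := by ring

theorem abs_xx (h0 : 0 < lam) (h1 : lam ≤ 1 / 10 ^ 6) (ha : ∀ n s, |a n s| ≤ 1) {s t : Om}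
    (h : s ≠ t) : |xx lam a s - xx lam a t| =
      2 * lam ^ firstDiff s t * Real.exp (a (firstDiff s t) (tr (firstDiff s t) s))
        * (1 + theta lam a s t) := by
  have h2 := theta_bd h0 h1 ha s t
  have h3 : 0 < 1 + theta lam a s t := by
    have := (abs_le.1 h2).1
    norm_num at h1
    linarith
  rw [xx_decomp h0 h1 ha h]
  set N := firstDiff s t with hN
  have hp := pow_pos h0 N
  have e : sg (s N) * (2 * lam ^ N * Real.exp (a N (tr N s))) + rest lam a s t
      = sg (s N) * (2 * lam ^ N * Real.exp (a N (tr N s)) * (1 + theta lam a s t)) := by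
    rw [theta, ← hN, Real.exp_neg]
    have := (Real.exp_pos (a N (tr N s))).ne'
    field_simp
    linear_combination (-rest lam a s t) * sg_mul_self (s N)
  rw [e, abs_mul, abs_sg, one_mul, abs_of_pos]
  positivity

theorem xx_low (h0 : 0 < lam) (h1 : lam ≤ 1 / 10 ^ 6) (ha : ∀ n s, |a n s| ≤ 1) {s t : Om}
    (h : s ≠ t) : 0.7 * lam ^ firstDiff s t ≤ |xx lam a s - xx lam a t| := by
  rw [abs_xx h0 h1 ha h]
  have h2 := (abs_le.1 (theta_bd h0 h1 ha s t)).1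
  have h3 := (exp_bd ha (firstDiff s t) (tr (firstDiff s t) s)).2
  have hp := pow_pos h0 (firstDiff s t)
  have h4 : 0.999 ≤ 1 + theta lam a s t := by norm_num at h1 ⊢; linarith
  calc 0.7 * lam ^ firstDiff s t ≤ 2 * lam ^ firstDiff s t * 0.36 * 0.999 := by linarith
    _ ≤ _ := by gcongr

theorem xx_cont (h0 : 0 < lam) (h1 : lam ≤ 1 / 10 ^ 6) (ha : ∀ n s, |a n s| ≤ 1) :
    Continuous (xx lam a) := by
  have hl : lam < 1 := by norm_num at h1; linarith
  refine continuous_tsum (u := fun k => 2.7183 * lam ^ k) (fun n => ?_)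
    ((summable_geometric_of_lt_one h0.le hl).mul_left _) (fun n s => term_bd h0 ha s n)
  unfold tmm
  have hsg : Continuous sg := continuous_of_discreteTopology
  have := cont_tr (a n) n
  exact ((hsg.comp (continuous_apply n)).mul continuous_const).mul (Real.continuous_exp.comp this)

theorem log_lip {u v : ℝ} (hu : |u| ≤ 1 / 2) (hv : |v| ≤ 1 / 2) :
    |Real.log (1 + u) - Real.log (1 + v)| ≤ 2 * |u - v| := by
  have aux : ∀ {u v : ℝ}, |u| ≤ 1 / 2 → |v| ≤ 1 / 2 →
      Real.log (1 + u) - Real.log (1 + v) ≤ 2 * |u - v| := by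
    intro u v hu hv
    have hu' := abs_le.1 hu
    have hv' := abs_le.1 hv
    have h1 : 0 < 1 + u := by linarith
    have h2 : 0 < 1 + v := by linarith
    rw [← Real.log_div h1.ne' h2.ne']
    refine (Real.log_le_sub_one_of_pos (by positivity)).trans ?_
    have : (1 + u) / (1 + v) - 1 = (u - v) / (1 + v) := by field_simp; ring
    rw [this, div_le_iff₀ h2]
    have := le_abs_self (u - v)
    have := abs_nonneg (u - v)
    nlinarith
  rw [abs_le]
  have h1 := aux hu hv
  have h2 := aux hv hu
  rw [abs_sub_comm v u] at h2
  constructor <;> linarith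

end
end CantorGreen

namespace CantorGreen
open PiNat

/-- the correction term in the logarithm of a difference -/
noncomputable def ww (lam : ℝ) (a : ℕ → Om → ℝ) (s t : Om) : ℝ :=
  open Classical in if t ∈ ({s} : Set Om) then 0 else
    Real.log |xx lam a s - xx lam a t| - Real.log (2 * lam ^ firstDiff s t)
      - a (firstDiff s t) (tr (firstDiff s t) s)

/-- the integrated correction -/
noncomputable def WW (lam : ℝ) (a : ℕ → Om → ℝ) (s : Om) : ℝ := ∫ t, ww lam a s t ∂om

section
variable {lam : ℝ} {a b : ℕ → Om → ℝ} {ε : ℝ}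

theorem ww_self (s : Om) : ww lam a s s = 0 := by simp [ww]

theorem ww_ne {s t : Om} (h : t ≠ s) : ww lam a s t =
    Real.log |xx lam a s - xx lam a t| - Real.log (2 * lam ^ firstDiff s t)
      - a (firstDiff s t) (tr (firstDiff s t) s) := by simp [ww, h]

theorem ww_meas (h0 : 0 < lam) (h1 : lam ≤ 1 / 10 ^ 6) (ha : ∀ n s, |a n s| ≤ 1) (s : Om) :
    Measurable (ww lam a s) := by
  unfold ww
  refine Measurable.ite (measurableSet_singleton s) measurable_const ?_
  have h2 := (xx_cont h0 h1 ha).measurable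
  have h3 : Measurable fun t => Real.log (2 * lam ^ firstDiff s t) :=
    (measurable_from_nat (f := fun k => Real.log (2 * lam ^ k))).comp (meas_fd s)
  have h4 : Measurable fun t => a (firstDiff s t) (tr (firstDiff s t) s) :=
    (measurable_from_nat (f := fun k => a k (tr k s))).comp (meas_fd s)
  have h5 : Measurable fun t => Real.log |xx lam a s - xx lam a t| := by fun_prop
  exact (h5.sub h3).sub h4

theorem ww_eq (h0 : 0 < lam) (h1 : lam ≤ 1 / 10 ^ 6) (ha : ∀ n s, |a n s| ≤ 1) {s t : Om}
    (h : t ≠ s) : ww lam a s t = Real.log (1 + theta lam a s t) := by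
  have h2 := (abs_le.1 (theta_bd h0 h1 ha s t)).1
  have h3 : 0 < 1 + theta lam a s t := by norm_num at h1; linarith
  have hp := pow_pos h0 (firstDiff s t)
  rw [ww_ne h, abs_xx h0 h1 ha h.symm, Real.log_mul (by positivity) h3.ne',
    Real.log_mul (by positivity) (Real.exp_pos _).ne', Real.log_exp]
  ring

theorem theta_half (h0 : 0 < lam) (h1 : lam ≤ 1 / 10 ^ 6) (ha : ∀ n s, |a n s| ≤ 1) (s t : Om) :
    |theta lam a s t| ≤ 1 / 2 := by
  have := theta_bd h0 h1 ha s t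
  norm_num at h1 ⊢; linarith

theorem ww_bd (h0 : 0 < lam) (h1 : lam ≤ 1 / 10 ^ 6) (ha : ∀ n s, |a n s| ≤ 1) (s t : Om) :
    |ww lam a s t| ≤ 18 * lam := by
  by_cases h : t = s
  · rw [h, ww_self, abs_zero]; positivity
  · rw [ww_eq h0 h1 ha h]
    have := log_lip (theta_half h0 h1 ha s t) (v := 0) (by norm_num)
    rw [add_zero, Real.log_one, sub_zero, sub_zero] at this
    have := theta_bd h0 h1 ha s t
    linarith

theorem ww_lip (h0 : 0 < lam) (h1 : lam ≤ 1 / 10 ^ 6) (ha : ∀ n s, |a n s| ≤ 1)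
    (hb : ∀ n s, |b n s| ≤ 1) (hab : ∀ n s, |a n s - b n s| ≤ ε) (s t : Om) :
    |ww lam a s t - ww lam b s t| ≤ 36 * lam * ε := by
  have := eps_nonneg hab
  by_cases h : t = s
  · rw [h, ww_self, ww_self, sub_zero, abs_zero]; positivity
  · rw [ww_eq h0 h1 ha h, ww_eq h0 h1 hb h]
    have := log_lip (theta_half h0 h1 ha s t) (theta_half h0 h1 hb s t)
    have := theta_lip h0 h1 ha hb hab s t
    linarith

/-- relative displacement -/
noncomputable def qq (lam : ℝ) (a : ℕ → Om → ℝ) (s s' t : Om) : ℝ :=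
  (xx lam a s - xx lam a s') / (xx lam a s' - xx lam a t)

theorem fd_eq {s s' t : Om} {n : ℕ} (hs : s' ∈ cylinder s n) (ht : t ≠ s)
    (hk : firstDiff s t < n) : t ≠ s' ∧ firstDiff s' t = firstDiff s t := by
  have hd := apply_firstDiff_ne ht.symm
  have hs' := mem_cylinder_iff.1 hs
  have hne : t ≠ s' := by
    rintro rfl
    exact hd (hs' _ hk).symm
  refine ⟨hne, ?_⟩
  have hd' := apply_firstDiff_ne hne.symm
  rcases lt_trichotomy (firstDiff s' t) (firstDiff s t) with h | h | h
  · exact absurd ((hs' _ (h.trans hk)).trans (apply_eq_of_lt_firstDiff h)) hd'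
  · exact h
  · exact absurd ((hs' _ hk).symm.trans (apply_eq_of_lt_firstDiff h)) hd

theorem fd_cyl (s t : Om) : t ∈ cylinder s (firstDiff s t) := by
  rw [firstDiff_comm]; exact mem_cylinder_firstDiff t s

/-- small factor -/
noncomputable def mu' (lam : ℝ) (n k : ℕ) : ℝ := lam * 4 * (1 / 4) ^ (n - k)

theorem mu_le (h0 : 0 < lam) (n k : ℕ) : 0 < mu' lam n k ∧ mu' lam n k ≤ 4 * lam := by
  unfold mu'
  refine ⟨by positivity, ?_⟩
  have : (1 / 4 : ℝ) ^ (n - k) ≤ 1 := pow_le_one₀ (by norm_num) (by norm_num)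
  nlinarith

theorem qq_bd (h0 : 0 < lam) (h1 : lam ≤ 1 / 10 ^ 6) (ha : ∀ n s, |a n s| ≤ 1)
    {s s' t : Om} {n : ℕ} (hs : s' ∈ cylinder s n) (ht : t ≠ s)
    (hk : firstDiff s t < n) : |qq lam a s s' t| ≤ 9 * mu' lam n (firstDiff s t) := by
  obtain ⟨hne, he⟩ := fd_eq hs ht hk
  have hl := xx_low h0 h1 ha hne.symm
  rw [he] at hl
  have hu := xx_bd h0 h1 ha hs
  have hp := pow_lam_le h0 h1 hk
  have hm := (mu_le h0 n (firstDiff s t)).1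
  have hpk := pow_pos h0 (firstDiff s t)
  change _ ≤ mu' lam n (firstDiff s t) * _ at hp
  rw [qq, abs_div, div_le_iff₀ (by linarith)]
  generalize mu' lam n (firstDiff s t) = m at *
  have h3 : m * (0.7 * lam ^ firstDiff s t) ≤ m * |xx lam a s' - xx lam a t| := by gcongr
  have : 0 < m * lam ^ firstDiff s t := by positivity
  linarith

theorem qq_lip (h0 : 0 < lam) (h1 : lam ≤ 1 / 10 ^ 6) (ha : ∀ n s, |a n s| ≤ 1)
    (hb : ∀ n s, |b n s| ≤ 1) (hab : ∀ n s, |a n s - b n s| ≤ ε)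
    {s s' t : Om} {n : ℕ} (hs : s' ∈ cylinder s n) (ht : t ≠ s)
    (hk : firstDiff s t < n) :
    |qq lam a s s' t - qq lam b s s' t| ≤ 83 * mu' lam n (firstDiff s t) * ε := by
  have hε := eps_nonneg hab
  obtain ⟨hne, he⟩ := fd_eq hs ht hk
  have hla := xx_low h0 h1 ha hne.symm
  have hlb := xx_low h0 h1 hb hne.symm
  have hq := xx_lip h0 h1 ha hb hab (fd_cyl s' t)
  rw [he] at hla hlb hq
  have hu := xx_bd h0 h1 hb hs
  have hv := xx_lip h0 h1 ha hb hab hs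
  have hp := pow_lam_le h0 h1 hk
  have hm := (mu_le h0 n (firstDiff s t)).1
  have hpk := pow_pos h0 (firstDiff s t)
  change _ ≤ mu' lam n (firstDiff s t) * _ at hp
  rw [qq, qq]
  generalize mu' lam n (firstDiff s t) = m at *
  generalize lam ^ firstDiff s t = L at *
  generalize lam ^ n = P at *
  generalize xx lam a s - xx lam a s' = Da at *
  generalize xx lam b s - xx lam b s' = Db at *
  generalize xx lam a s' - xx lam a t = Ea at *
  generalize xx lam b s' - xx lam b t = Eb at *
  have hEa : Ea ≠ 0 := abs_pos.1 (by linarith)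
  have hEb : Eb ≠ 0 := abs_pos.1 (by linarith)
  have e : Da / Ea - Db / Eb = (Da - Db) / Ea + - (Db * (Ea - Eb) / (Ea * Eb)) := by
    field_simp; ring
  rw [e]
  refine (abs_add_le _ _).trans ?_
  rw [abs_neg, abs_div, abs_div, abs_mul, abs_mul]
  calc |Da - Db| / |Ea| + |Db| * |Ea - Eb| / (|Ea| * |Eb|)
      ≤ (6 * ε * (m * L)) / (0.7 * L) + (6 * (m * L)) * (6 * ε * L) / ((0.7 * L) * (0.7 * L)) := by
        have h2 : |Da - Db| ≤ 6 * ε * (m * L) := hv.trans (by gcongr)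
        have h3 : |Db| ≤ 6 * (m * L) := hu.trans (by gcongr)
        gcongr
    _ = (6 / 0.7 + 36 / 0.49) * (m * ε) := by field_simp; ring
    _ ≤ 83 * (m * ε) := by gcongr; norm_num
    _ = _ := by ring

theorem ww_diff (h0 : 0 < lam) (h1 : lam ≤ 1 / 10 ^ 6) (ha : ∀ n s, |a n s| ≤ 1)
    {s s' t : Om} {n : ℕ} (hs : s' ∈ cylinder s n) (ht : t ≠ s)
    (hk : firstDiff s t < n) :
    |qq lam a s s' t| ≤ 1 / 2 ∧ ww lam a s t - ww lam a s' t = Real.log (1 + qq lam a s s' t) := by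
  have hq := qq_bd h0 h1 ha hs ht hk
  have hm := (mu_le h0 n (firstDiff s t)).2
  have hq2 : |qq lam a s s' t| ≤ 1 / 2 := by norm_num at h1 ⊢; linarith
  refine ⟨hq2, ?_⟩
  obtain ⟨hne, he⟩ := fd_eq hs ht hk
  have hl := xx_low h0 h1 ha hne.symm
  have hp := pow_pos h0 (firstDiff s' t)
  have hE : xx lam a s' - xx lam a t ≠ 0 := abs_pos.1 (by linarith)
  have h3 : 0 < 1 + qq lam a s s' t := by have := (abs_le.1 hq2).1; linarith
  have e : xx lam a s - xx lam a t = (xx lam a s' - xx lam a t) * (1 + qq lam a s s' t) := by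
    rw [qq]; field_simp; ring
  rw [ww_ne ht, ww_ne hne, he, tr_eq hs hk.le, e, abs_mul, Real.log_mul (abs_pos.2 hE).ne'
    (abs_pos.2 h3.ne').ne', abs_of_pos h3]
  ring

theorem ww_int (h0 : 0 < lam) (h1 : lam ≤ 1 / 10 ^ 6) (ha : ∀ n s, |a n s| ≤ 1) (s : Om) :
    Integrable (ww lam a s) om := by
  refine integrable_of_bfun s (ww_meas h0 h1 ha s) (n := 0) (A := 0) (B := 18 * lam) (D := 0) ?_
  intro t _
  simpa [bfun] using ww_bd h0 h1 ha s t

theorem WW_bd (h0 : 0 < lam) (h1 : lam ≤ 1 / 10 ^ 6) (ha : ∀ n s, |a n s| ≤ 1)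
    {s s' : Om} {n : ℕ} (hs : s' ∈ cylinder s n) :
    |WW lam a s - WW lam a s'| ≤ (1 / 2) ^ n * (72 * lam) := by
  rw [WW, WW, ← integral_sub (ww_int h0 h1 ha s) (ww_int h0 h1 ha s')]
  refine (abs_integral_le_of_bfun s (n := n) (A := 72 * lam) (B := 36 * lam) (D := 0)
    ((ww_meas h0 h1 ha s).sub (ww_meas h0 h1 ha s')) (by positivity) ?_).trans ?_
  · intro t ht
    rw [Pi.sub_apply]
    unfold bfun
    split_ifs with hk
    · obtain ⟨h2, h3⟩ := ww_diff h0 h1 ha hs ht hk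
      rw [h3]
      have := log_lip h2 (v := 0) (by norm_num)
      rw [add_zero, Real.log_one, sub_zero, sub_zero] at this
      have := qq_bd h0 h1 ha hs ht hk
      unfold mu' at this
      linarith
    · have h2 := ww_bd h0 h1 ha s t
      have h3 := ww_bd h0 h1 ha s' t
      have := abs_sub (ww lam a s t) (ww lam a s' t)
      linarith
  · apply le_of_eq; ring

theorem WW_lip (h0 : 0 < lam) (h1 : lam ≤ 1 / 10 ^ 6) (ha : ∀ n s, |a n s| ≤ 1)
    (hb : ∀ n s, |b n s| ≤ 1) (hab : ∀ n s, |a n s - b n s| ≤ ε)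
    {s s' : Om} {n : ℕ} (hs : s' ∈ cylinder s n) :
    |(WW lam a s - WW lam a s') - (WW lam b s - WW lam b s')| ≤ (1 / 2) ^ n * (404 * lam * ε) := by
  have hε := eps_nonneg hab
  rw [WW, WW, WW, WW, ← integral_sub' (ww_int h0 h1 ha s) (ww_int h0 h1 ha s'),
    ← integral_sub' (ww_int h0 h1 hb s) (ww_int h0 h1 hb s'),
    ← integral_sub' ((ww_int h0 h1 ha s).sub (ww_int h0 h1 ha s'))
      ((ww_int h0 h1 hb s).sub (ww_int h0 h1 hb s'))]
  refine (abs_integral_le_of_bfun s (n := n) (A := 664 * lam * ε) (B := 72 * lam * ε) (D := 0)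
    (((ww_meas h0 h1 ha s).sub (ww_meas h0 h1 ha s')).sub
      ((ww_meas h0 h1 hb s).sub (ww_meas h0 h1 hb s'))) (by positivity) ?_).trans ?_
  · intro t ht
    rw [Pi.sub_apply, Pi.sub_apply, Pi.sub_apply]
    unfold bfun
    split_ifs with hk
    · obtain ⟨h2, h3⟩ := ww_diff h0 h1 ha hs ht hk
      obtain ⟨h4, h5⟩ := ww_diff h0 h1 hb hs ht hk
      rw [h3, h5]
      have := log_lip h2 h4
      have := qq_lip h0 h1 ha hb hab hs ht hk
      unfold mu' at this
      linarith
    · have h2 := ww_lip h0 h1 ha hb hab s t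
      have h3 := ww_lip h0 h1 ha hb hab s' t
      have := abs_sub (ww lam a s t - ww lam b s t) (ww lam a s' t - ww lam b s' t)
      rw [show ww lam a s t - ww lam a s' t - (ww lam b s t - ww lam b s' t) =
        (ww lam a s t - ww lam b s t) - (ww lam a s' t - ww lam b s' t) by ring]
      linarith
  · apply le_of_eq; ring

end
end CantorGreen

namespace CantorGreen
open PiNat

/-- clamping to `[-1,1]` -/
noncomputable def cl (f : ℕ × Om → ℝ) (n : ℕ) (s : Om) : ℝ := max (-1) (min 1 (f (n, s)))

theorem cl_bd (f : ℕ × Om → ℝ) (n : ℕ) (s : Om) : |cl f n s| ≤ 1 := by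
  unfold cl
  rw [abs_le]
  exact ⟨le_max_left _ _, max_le (by norm_num) (min_le_left _ _)⟩

theorem cl_lip (f g : ℕ × Om → ℝ) (n : ℕ) (s : Om) :
    |cl f n s - cl g n s| ≤ |f (n, s) - g (n, s)| := by
  unfold cl
  refine (abs_max_sub_max_le_max _ _ _ _).trans ?_
  rw [sub_self, abs_zero]
  refine max_le (abs_nonneg _) ((abs_min_sub_min_le_max _ _ _ _).trans ?_)
  rw [sub_self, abs_zero]
  exact max_le (abs_nonneg _) le_rfl

/-- the fixed point map -/
noncomputable def phi (lam : ℝ) (a : ℕ → Om → ℝ) : ℕ → Om → ℝ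
  | 0, _ => 0
  | n + 1, s => -2 ^ (n + 2) * (WW lam a (tr n s) - WW lam a (tr (n + 1) s)) * (-1)

theorem tr_cyl (n : ℕ) (s : Om) : tr (n + 1) s ∈ cylinder (tr n s) n := by
  rw [mem_cylinder_iff]
  intro i hi
  simp [tr, hi, hi.trans (Nat.lt_succ_self n)]

section
variable {lam : ℝ} {a b : ℕ → Om → ℝ} {ε : ℝ}

theorem two_pow_aux (n : ℕ) : (2 : ℝ) ^ (n + 2) * (1 / 2) ^ n = 4 := by
  have : (2 : ℝ) ^ n * (1 / 2) ^ n = 1 := by rw [← mul_pow]; norm_num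
  linear_combination 4 * this

theorem phi_bd (h0 : 0 < lam) (h1 : lam ≤ 1 / 10 ^ 6) (ha : ∀ n s, |a n s| ≤ 1) (n : ℕ) (s : Om) :
    |phi lam a n s| ≤ 1 := by
  cases n with
  | zero => simp [phi]
  | succ n =>
    have h := WW_bd h0 h1 ha (tr_cyl n s)
    rw [phi, abs_mul, abs_mul, abs_neg, abs_neg, abs_one, mul_one,
      abs_of_pos (by positivity : (0 : ℝ) < 2 ^ (n + 2))]
    calc _ ≤ (2 : ℝ) ^ (n + 2) * ((1 / 2) ^ n * (72 * lam)) := by gcongr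
      _ = 4 * (72 * lam) := by rw [← mul_assoc, two_pow_aux]
      _ ≤ 1 := by norm_num at h1 ⊢; linarith

theorem phi_lip (h0 : 0 < lam) (h1 : lam ≤ 1 / 10 ^ 6) (ha : ∀ n s, |a n s| ≤ 1)
    (hb : ∀ n s, |b n s| ≤ 1) (hab : ∀ n s, |a n s - b n s| ≤ ε) (n : ℕ) (s : Om) :
    |phi lam a n s - phi lam b n s| ≤ 1 / 2 * ε := by
  have hε := eps_nonneg hab
  cases n with
  | zero => simp [phi]; exact hε
  | succ n =>
    have h := WW_lip h0 h1 ha hb hab (tr_cyl n s)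
    rw [phi, phi, ← sub_mul, ← mul_sub, abs_mul, abs_mul, abs_neg, abs_neg, abs_one, mul_one,
      abs_of_pos (by positivity : (0 : ℝ) < 2 ^ (n + 2))]
    calc _ ≤ (2 : ℝ) ^ (n + 2) * ((1 / 2) ^ n * (404 * lam * ε)) := by gcongr
      _ = 4 * (404 * lam * ε) := by rw [← mul_assoc, two_pow_aux]
      _ = (1616 * lam) * ε := by ring
      _ ≤ 1 / 2 * ε := by gcongr; norm_num at h1 ⊢; linarith

/-- the Banach space of bounded parameters -/
abbrev Pm := lp (fun _ : ℕ × Om => ℝ) ⊤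

theorem exists_fix (h0 : 0 < lam) (h1 : lam ≤ 1 / 10 ^ 6) :
    ∃ a : ℕ → Om → ℝ, (∀ n s, |a n s| ≤ 1) ∧ ∀ n s, a n s = phi lam a n s := by
  have hmem : ∀ f : Pm, Memℓp (fun p : ℕ × Om => phi lam (cl f) p.1 p.2) ⊤ := by
    intro f
    apply memℓp_infty
    refine ⟨1, ?_⟩
    rintro _ ⟨p, rfl⟩
    exact phi_bd h0 h1 (cl_bd f) p.1 p.2
  let F : Pm → Pm := fun f => ⟨fun p => phi lam (cl f) p.1 p.2, hmem f⟩
  have hF : ContractingWith (1 / 2) F := by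
    refine ⟨by rw [← NNReal.coe_lt_coe]; norm_num, LipschitzWith.of_dist_le_mul fun f g => ?_⟩
    rw [dist_eq_norm, dist_eq_norm]
    refine lp.norm_le_of_forall_le (by positivity) fun p => ?_
    have := phi_lip h0 h1 (cl_bd f) (cl_bd g) (ε := ‖f - g‖) (fun n s =>
      (cl_lip f g n s).trans (lp.norm_apply_le_norm (by simp) (f - g) (n, s))) p.1 p.2
    simpa using this
  have hfix := hF.fixedPoint_isFixedPt
  generalize ContractingWith.fixedPoint F hF = f at hfix
  have hf : ∀ n s, f (n, s) = phi lam (cl f) n s := by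
    intro n s
    conv_lhs => rw [← hfix.eq]
  have hc : ∀ n s, cl f n s = f (n, s) := by
    intro n s
    have := abs_le.1 (phi_bd h0 h1 (cl_bd f) n s)
    rw [← hf] at this
    rw [cl, min_eq_right this.2, max_eq_right this.1]
  refine ⟨cl f, cl_bd f, fun n s => ?_⟩
  rw [hc, hf]

theorem WW_tendsto (h0 : 0 < lam) (h1 : lam ≤ 1 / 10 ^ 6) (ha : ∀ n s, |a n s| ≤ 1) (s : Om) :
    Filter.Tendsto (fun n => WW lam a (tr n s)) Filter.atTop (nhds (WW lam a s)) := by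
  rw [tendsto_iff_dist_tendsto_zero]
  have hz : Filter.Tendsto (fun n : ℕ => (1 / 2 : ℝ) ^ n * (72 * lam)) Filter.atTop (nhds 0) := by
    have := (tendsto_pow_atTop_nhds_zero_of_lt_one (r := (1 / 2 : ℝ)) (by norm_num)
      (by norm_num)).mul_const (72 * lam)
    rwa [zero_mul] at this
  refine squeeze_zero (fun _ => dist_nonneg) (fun n => ?_) hz
  rw [dist_comm, Real.dist_eq]
  exact WW_bd h0 h1 ha (tr_mem s n)

theorem a_summable (ha : ∀ n s, |a n s| ≤ 1) (s : Om) :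
    Summable fun k => (1 / 2 : ℝ) ^ (k + 1) * |a k (tr k s)| := by
  refine Summable.of_nonneg_of_le (fun k => by positivity) (fun k => ?_)
    (bfun_summable 0 0 1 0)
  have := ha k (tr k s)
  simp only [bfun, Nat.not_lt_zero, if_false]
  norm_num
  exact this

theorem a_sum (h0 : 0 < lam) (h1 : lam ≤ 1 / 10 ^ 6) (ha : ∀ n s, |a n s| ≤ 1)
    (hfix : ∀ n s, a n s = phi lam a n s) (s : Om) :
    ∑' k, (1 / 2 : ℝ) ^ (k + 1) * a k (tr k s) = WW lam a (fun _ => false) - WW lam a s := by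
  have hs : Summable fun k => (1 / 2 : ℝ) ^ (k + 1) * a k (tr k s) := by
    refine Summable.of_abs ((a_summable ha s).congr fun k => ?_)
    rw [abs_mul, abs_of_nonneg (by positivity : (0:ℝ) ≤ (1 / 2) ^ (k + 1))]
  have h2 := hs.hasSum.tendsto_sum_nat.comp (Filter.tendsto_add_atTop_nat 1)
  refine tendsto_nhds_unique h2 ?_
  have h3 : ∀ M : ℕ, ∑ k ∈ Finset.range (M + 1), (1 / 2 : ℝ) ^ (k + 1) * a k (tr k s)
      = WW lam a (fun _ => false) - WW lam a (tr M s) := by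
    intro M
    induction M with
    | zero => rw [tr_zero]; simp [hfix 0, phi]
    | succ M ih =>
      rw [Finset.sum_range_succ, ih, hfix (M + 1), phi, tr_tr (Nat.le_succ M), tr_tr le_rfl]
      have : (1 / 2 : ℝ) ^ (M + 1 + 1) * 2 ^ (M + 2) = 1 := by
        rw [← mul_pow]; norm_num
      linear_combination (WW lam a (tr M s) - WW lam a (tr (M + 1) s)) * this
  refine Filter.Tendsto.congr (fun M => (h3 M).symm) ?_
  exact (WW_tendsto h0 h1 ha s).const_sub _

end
end CantorGreen

namespace CantorGreen
open PiNat

section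
variable {lam : ℝ} {a : ℕ → Om → ℝ}

theorem log_summable (h0 : 0 < lam) :
    Summable fun k => (1 / 2 : ℝ) ^ (k + 1) * |Real.log (2 * lam ^ k)| := by
  refine (bfun_summable 0 0 (Real.log 2) (Real.log lam)).congr fun k => ?_
  simp only [bfun, Nat.not_lt_zero, if_false]
  rw [Real.log_mul (by norm_num) (pow_pos h0 k).ne', Real.log_pow]
  congr 2
  push_cast
  ring

theorem xx_pot (h0 : 0 < lam) (h1 : lam ≤ 1 / 10 ^ 6) (ha : ∀ n s, |a n s| ≤ 1)
    (hfix : ∀ n s, a n s = phi lam a n s) (s : Om) :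
    Integrable (fun t => Real.log |xx lam a s - xx lam a t|) om ∧
    ∫ t, Real.log |xx lam a s - xx lam a t| ∂om =
      (∫ k, Real.log (2 * lam ^ k) ∂nu) + WW lam a (fun _ => false) := by
  have i1 := integrable_fd s (log_summable h0)
  have i2 := integrable_fd s (a_summable ha s)
  have i3 := ww_int h0 h1 ha s
  have hae : (fun t => Real.log |xx lam a s - xx lam a t|) =ᵐ[om] fun t =>
      Real.log (2 * lam ^ firstDiff s t) + a (firstDiff s t) (tr (firstDiff s t) s)
        + ww lam a s t := by
    filter_upwards [ae_ne s] with t ht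
    rw [ww_ne ht]; ring
  have i12 : Integrable (fun t => Real.log (2 * lam ^ firstDiff s t)
      + a (firstDiff s t) (tr (firstDiff s t) s)) om := i1.add i2
  refine ⟨(i12.add i3).congr hae.symm, ?_⟩
  rw [integral_congr_ae hae, integral_add i12 i3, integral_add i1 i2,
    integral_fd s (fun k => Real.log (2 * lam ^ k)), integral_fd s (fun k => a k (tr k s)),
    integral_nu (f := fun k => a k (tr k s)) (a_summable ha s), a_sum h0 h1 ha hfix]
  change _ + (_ - _) + WW lam a s = _
  ring

theorem exists_emb (lam : ℝ) (h0 : 0 < lam) (h1 : lam ≤ 1 / 10 ^ 6) : ∃ c X, Emb lam c X := by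
  obtain ⟨a, ha, hfix⟩ := exists_fix h0 h1
  set u : ℝ := (∫ k, Real.log (2 * lam ^ k) ∂nu) + WW lam a (fun _ => false) with hu
  have he := Real.exp_pos (-u)
  have hsub : ∀ s t, |Real.exp (-u) * xx lam a s - Real.exp (-u) * xx lam a t|
      = Real.exp (-u) * |xx lam a s - xx lam a t| := by
    intro s t
    rw [← mul_sub, abs_mul, abs_of_pos he]
  refine ⟨0.7 * Real.exp (-u), fun s => Real.exp (-u) * xx lam a s, h0, h1, by positivity,
    continuous_const.mul (xx_cont h0 h1 ha), ?_, ?_, ?_⟩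
  · intro s t hst
    rw [hsub]
    have := xx_low h0 h1 ha hst
    nlinarith
  · intro s t hst
    rw [hsub]
    have := xx_bd h0 h1 ha (fd_cyl s t)
    have hp := pow_pos h0 (firstDiff s t)
    calc _ ≤ Real.exp (-u) * (6 * lam ^ firstDiff s t) := by gcongr
      _ ≤ Real.exp (-u) * (7 * lam ^ firstDiff s t) := by gcongr; norm_num
      _ = _ := by ring
  · intro s
    obtain ⟨hi, hp⟩ := xx_pot h0 h1 ha hfix s
    have hae : (fun t => Real.log |Real.exp (-u) * xx lam a s - Real.exp (-u) * xx lam a t|)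
        =ᵐ[om] fun t => -u + Real.log |xx lam a s - xx lam a t| := by
      filter_upwards [ae_ne s] with t ht
      have h2 := xx_low h0 h1 ha ht.symm
      have h3 := pow_pos h0 (firstDiff s t)
      rw [hsub, Real.log_mul he.ne' (by intro h; rw [h] at h2; linarith), Real.log_exp]
    rw [integral_congr_ae hae, integral_add (integrable_const _) hi, hp, ← hu]
    simp

end
end CantorGreen

/-- There exists `δ_M ∈ (0,1]` such that for every `δ ∈ (0,δ_M)` there are:
a compact set `K ⊂ ℝ×{0} ⊂ ℝ²` (identified with the real axis of `ℂ`) with at least two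
points, Ahlfors regular of dimension `δ`; a constant `C ≥ 1`; and a continuous function
`G : ℝ² → [0,∞)` with `G = 0` exactly on `K`, harmonic (smooth with vanishing Laplacian) on
`ℝ² \ K`, satisfying `C⁻¹ dist(y,K)^δ ≤ G(y) ≤ C dist(y,K)^δ` for `0 < dist(y,K) ≤ 1`, and
`G(y) − ln|y| → 0` as `|y| → ∞`: `G` is the Green function of `ℝ² \ K` with pole at
infinity. -/
theorem stmt11 :
    ∃ δM : ℝ, 0 < δM ∧ δM ≤ 1 ∧
      ∀ δ : ℝ, 0 < δ → δ < δM →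
      ∃ K : Set ℂ,
        IsCompact K ∧
        K ⊆ {z : ℂ | z.im = 0} ∧
        (∃ p ∈ K, ∃ q ∈ K, p ≠ q) ∧
        (∃ (μ : Measure ℂ) (C₀ : ℝ), 1 ≤ C₀ ∧ μ Kᶜ = 0 ∧ μ ≠ 0 ∧
          ∀ x ∈ K, ∀ ρ : ℝ, 0 < ρ → ρ ≤ Metric.diam K →
            C₀⁻¹ * ρ ^ δ ≤ (μ (Metric.closedBall x ρ)).toReal ∧
            (μ (Metric.closedBall x ρ)).toReal ≤ C₀ * ρ ^ δ) ∧
        ∃ (C : ℝ) (G : ℂ → ℝ),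
          1 ≤ C ∧
          Continuous G ∧
          (∀ y, 0 ≤ G y) ∧
          (∀ y, G y = 0 ↔ y ∈ K) ∧
          ContDiffOn ℝ (⊤ : ℕ∞) G Kᶜ ∧
          (∀ y ∈ Kᶜ,
            iteratedFDeriv ℝ 2 G y ![1, 1] +
              iteratedFDeriv ℝ 2 G y ![Complex.I, Complex.I] = 0) ∧
          (∀ y : ℂ, 0 < Metric.infDist y K → Metric.infDist y K ≤ 1 →
            C⁻¹ * Metric.infDist y K ^ δ ≤ G y ∧ G y ≤ C * Metric.infDist y K ^ δ) ∧
          Filter.Tendsto (fun y : ℂ => G y - Real.log ‖y‖)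
            (Filter.comap (fun y : ℂ => ‖y‖) Filter.atTop) (nhds 0) := by
  exact CantorGreen.final CantorGreen.exists_emb
end
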